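/- arXiv:2102.00296 — 4 statements merged into one kernel-verified Lean document; each statement's English description precedes it below -/
import Mathlib

section
/- Let X be an infinite Hausdorff space and n ≥ 1. (a) If 𝒰 is an ω-cover of X, then { U^{≤n} : U ∈ 𝒰 } is an ω-cover of X^{≤n}. (b) If 𝒰 is an ω-cover of X^{≤n}, then 𝒱 = { V ∈ 𝒯_X : there exists U ∈ 𝒰 with V^{≤n} ⊆ U } is an ω-cover of X. -/
open Set

section Covers

variable (Y : Type*) [TopologicalSpace Y]

/-- The collection `𝒯_Y` of proper nonempty open subsets of `Y`. -/
def ProperNonemptyOpens : Set (Set Y) :=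
  {U | IsOpen U ∧ U.Nonempty ∧ U ≠ Set.univ}

/-- A non-trivial open cover: an open cover not containing the whole space. -/
def IsNontrivialOpenCover (𝒰 : Set (Set Y)) : Prop :=
  (∀ U ∈ 𝒰, IsOpen U) ∧ ⋃₀ 𝒰 = Set.univ ∧ Set.univ ∉ 𝒰

/-- An ω-cover: a non-trivial open cover such that every finite subset of the
space is contained in some member. -/
def IsOmegaCover (𝒰 : Set (Set Y)) : Prop :=
  IsNontrivialOpenCover Y 𝒰 ∧ ∀ F : Set Y, F.Finite → ∃ U ∈ 𝒰, F ⊆ U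

/-- A k-cover: a non-trivial open cover such that every compact proper subset of
the space is contained in some member. -/
def IsKCover (𝒰 : Set (Set Y)) : Prop :=
  IsNontrivialOpenCover Y 𝒰 ∧ ∀ K : Set Y, IsCompact K → K ≠ Set.univ → ∃ U ∈ 𝒰, K ⊆ U

/-- An `𝒜`-cover: a non-trivial open cover such that every `A ∈ 𝒜` is contained
in some member. -/
def IsACover (𝒜 𝒰 : Set (Set Y)) : Prop :=
  IsNontrivialOpenCover Y 𝒰 ∧ ∀ A ∈ 𝒜, ∃ U ∈ 𝒰, A ⊆ U

/-- `O_Y`: the collection of non-trivial open covers of `Y`. -/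
def openCovers : Set (Set (Set Y)) := {𝒰 | IsNontrivialOpenCover Y 𝒰}

/-- `Ω_Y`: the collection of ω-covers of `Y`. -/
def omegaCovers : Set (Set (Set Y)) := {𝒰 | IsOmegaCover Y 𝒰}

/-- `K_Y`: the collection of k-covers of `Y`. -/
def kCovers : Set (Set (Set Y)) := {𝒰 | IsKCover Y 𝒰}

/-- `O(Y,𝒜)`: the collection of `𝒜`-covers of `Y`. -/
def aCovers (𝒜 : Set (Set Y)) : Set (Set (Set Y)) := {𝒰 | IsACover Y 𝒜 𝒰}

/-- Lindelöf: every open cover has a countable subcover. -/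
def IsLindelofSp : Prop :=
  ∀ 𝒰 : Set (Set Y), (∀ U ∈ 𝒰, IsOpen U) → ⋃₀ 𝒰 = Set.univ →
    ∃ 𝒱 ⊆ 𝒰, 𝒱.Countable ∧ ⋃₀ 𝒱 = Set.univ

/-- ε-space: every ω-cover has a countable subset which is still an ω-cover. -/
def IsEpsilonSpace : Prop :=
  ∀ 𝒰 : Set (Set Y), IsOmegaCover Y 𝒰 → ∃ 𝒱 ⊆ 𝒰, 𝒱.Countable ∧ IsOmegaCover Y 𝒱

/-- k-Lindelöf: every k-cover has a countable subset which is still a k-cover. -/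
def IsKLindelof : Prop :=
  ∀ 𝒰 : Set (Set Y), IsKCover Y 𝒰 → ∃ 𝒱 ⊆ 𝒰, 𝒱.Countable ∧ IsKCover Y 𝒱

end Covers

section Games

variable {ι κ : Type*}

/-- The selection principle `S_1(A, B)`. -/
def S1 (A B : Set (Set ι)) : Prop :=
  ∀ a : ℕ → Set ι, (∀ n, a n ∈ A) →
    ∃ x : ℕ → ι, (∀ n, x n ∈ a n) ∧ Set.range x ∈ B

/-- The selection principle `S_fin(A, B)`. -/
def Sfin (A B : Set (Set ι)) : Prop :=
  ∀ a : ℕ → Set ι, (∀ n, a n ∈ A) →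
    ∃ F : ℕ → Set ι, (∀ n, F n ⊆ a n ∧ (F n).Finite) ∧ (⋃ n, F n) ∈ B

/-- One has a winning (full-information) strategy in the single-selection game
`G_1(A, B)`: a function from finite sequences of Two's moves into `A` such that
every legal run produces a set of Two's selections which is not in `B`. -/
def OneWin1 (A B : Set (Set ι)) : Prop :=
  ∃ σ : List ι → Set ι, (∀ h, σ h ∈ A) ∧
    ∀ x : ℕ → ι, (∀ n, x n ∈ σ (List.ofFn fun i : Fin n => x i)) → Set.range x ∉ B

/-- One has a winning predetermined strategy in `G_1(A, B)`. -/
def OnePre1 (A B : Set (Set ι)) : Prop :=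
  ∃ σ : ℕ → Set ι, (∀ n, σ n ∈ A) ∧
    ∀ x : ℕ → ι, (∀ n, x n ∈ σ n) → Set.range x ∉ B

/-- One has a winning constant strategy in `G_1(A, B)`. -/
def OneConst1 (A B : Set (Set ι)) : Prop :=
  ∃ A₀ ∈ A, ∀ x : ℕ → ι, (∀ n, x n ∈ A₀) → Set.range x ∉ B

/-- Two has a winning (full-information) strategy in `G_1(A, B)`. -/
def TwoWin1 (A B : Set (Set ι)) : Prop :=
  ∃ τ : List (Set ι) → ι, ∀ a : ℕ → Set ι, (∀ n, a n ∈ A) →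
    (∀ n, τ (List.ofFn fun i : Fin (n + 1) => a i) ∈ a n) ∧
    Set.range (fun n => τ (List.ofFn fun i : Fin (n + 1) => a i)) ∈ B

/-- Two has a winning Markov strategy in `G_1(A, B)`. -/
def TwoMarkov1 (A B : Set (Set ι)) : Prop :=
  ∃ τ : Set ι → ℕ → ι, ∀ a : ℕ → Set ι, (∀ n, a n ∈ A) →
    (∀ n, τ (a n) n ∈ a n) ∧ Set.range (fun n => τ (a n) n) ∈ B

/-- One has a winning (full-information) strategy in the finite-selection game
`G_fin(A, B)`. -/
def OneWinFin (A B : Set (Set ι)) : Prop :=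
  ∃ σ : List (Set ι) → Set ι, (∀ h, σ h ∈ A) ∧
    ∀ F : ℕ → Set ι,
      (∀ n, F n ⊆ σ (List.ofFn fun i : Fin n => F i) ∧ (F n).Finite) →
      (⋃ n, F n) ∉ B

/-- One has a winning predetermined strategy in `G_fin(A, B)`. -/
def OnePreFin (A B : Set (Set ι)) : Prop :=
  ∃ σ : ℕ → Set ι, (∀ n, σ n ∈ A) ∧
    ∀ F : ℕ → Set ι, (∀ n, F n ⊆ σ n ∧ (F n).Finite) → (⋃ n, F n) ∉ B

/-- One has a winning constant strategy in `G_fin(A, B)`. -/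
def OneConstFin (A B : Set (Set ι)) : Prop :=
  ∃ A₀ ∈ A, ∀ F : ℕ → Set ι, (∀ n, F n ⊆ A₀ ∧ (F n).Finite) → (⋃ n, F n) ∉ B

/-- Two has a winning (full-information) strategy in `G_fin(A, B)`. -/
def TwoWinFin (A B : Set (Set ι)) : Prop :=
  ∃ τ : List (Set ι) → Set ι, ∀ a : ℕ → Set ι, (∀ n, a n ∈ A) →
    (∀ n, τ (List.ofFn fun i : Fin (n + 1) => a i) ⊆ a n ∧
      (τ (List.ofFn fun i : Fin (n + 1) => a i)).Finite) ∧
    (⋃ n, τ (List.ofFn fun i : Fin (n + 1) => a i)) ∈ B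

/-- Two has a winning Markov strategy in `G_fin(A, B)`. -/
def TwoMarkovFin (A B : Set (Set ι)) : Prop :=
  ∃ τ : Set ι → ℕ → Set ι, ∀ a : ℕ → Set ι, (∀ n, a n ∈ A) →
    (∀ n, τ (a n) n ⊆ a n ∧ (τ (a n) n).Finite) ∧ (⋃ n, τ (a n) n) ∈ B

/-- `G_1(A,C) ≤_II G_1(B,D)`. -/
def LeTwo1 (A C : Set (Set ι)) (B D : Set (Set κ)) : Prop :=
  (TwoMarkov1 A C → TwoMarkov1 B D) ∧
  (TwoWin1 A C → TwoWin1 B D) ∧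
  (¬ OneWin1 A C → ¬ OneWin1 B D) ∧
  (¬ OnePre1 A C → ¬ OnePre1 B D) ∧
  (¬ OneConst1 A C → ¬ OneConst1 B D)

/-- `G_fin(A,C) ≤_II G_fin(B,D)`. -/
def LeTwoFin (A C : Set (Set ι)) (B D : Set (Set κ)) : Prop :=
  (TwoMarkovFin A C → TwoMarkovFin B D) ∧
  (TwoWinFin A C → TwoWinFin B D) ∧
  (¬ OneWinFin A C → ¬ OneWinFin B D) ∧
  (¬ OnePreFin A C → ¬ OnePreFin B D) ∧
  (¬ OneConstFin A C → ¬ OneConstFin B D)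

/-- `G_1(A,C) ≡ G_1(B,D)`. -/
def Equiv1 (A C : Set (Set ι)) (B D : Set (Set κ)) : Prop :=
  (TwoMarkov1 A C ↔ TwoMarkov1 B D) ∧
  (TwoWin1 A C ↔ TwoWin1 B D) ∧
  (OneWin1 A C ↔ OneWin1 B D) ∧
  (OnePre1 A C ↔ OnePre1 B D) ∧
  (OneConst1 A C ↔ OneConst1 B D)

/-- `G_fin(A,C) ≡ G_fin(B,D)`. -/
def EquivFin (A C : Set (Set ι)) (B D : Set (Set κ)) : Prop :=
  (TwoMarkovFin A C ↔ TwoMarkovFin B D) ∧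
  (TwoWinFin A C ↔ TwoWinFin B D) ∧
  (OneWinFin A C ↔ OneWinFin B D) ∧
  (OnePreFin A C ↔ OnePreFin B D) ∧
  (OneConstFin A C ↔ OneConstFin B D)

end Games

section Hyperspace

variable (X : Type*) [TopologicalSpace X]

/-- `𝕂(X)`: the nonempty compact subsets of `X`. -/
abbrev KHyper := {K : Set X // IsCompact K ∧ K.Nonempty}

/-- The Vietoris topology on `𝕂(X)`, generated by the sets
`{K : K ⊆ U}` and `{K : K ∩ U ≠ ∅}` for `U` open in `X`. -/
instance (priority := 2000) vietorisTopology : TopologicalSpace (KHyper X) :=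
  TopologicalSpace.generateFrom
    ({S | ∃ U : Set X, IsOpen U ∧ S = {K : KHyper X | K.1 ⊆ U}} ∪
     {S | ∃ U : Set X, IsOpen U ∧ S = {K : KHyper X | (K.1 ∩ U).Nonempty}})

/-- `[U] = {K ∈ 𝕂(X) : K ⊆ U}`. -/
def vLower (U : Set X) : Set (KHyper X) := {K | K.1 ⊆ U}

/-- `P_fin(X)`: the subspace of `𝕂(X)` of nonempty finite subsets of `X`. -/
abbrev PFinH := {K : KHyper X // K.1.Finite}

/-- A family `𝒜` of subsets of `X` viewed as a subspace `𝔸` of `𝕂(X)`. -/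
abbrev ASub (𝒜 : Set (Set X)) := {K : KHyper X // K.1 ∈ 𝒜}

end Hyperspace

/-- An ideal of compact proper subsets of a space: closed under finite unions
and under compact subsets. -/
def IsCompactIdealOn {Y : Type*} [TopologicalSpace Y] (ℬ : Set (Set Y)) : Prop :=
  (∀ B ∈ ℬ, IsCompact B ∧ B ≠ Set.univ) ∧
  (∀ B ∈ ℬ, ∀ C ∈ ℬ, B ∪ C ∈ ℬ) ∧
  (∀ B ∈ ℬ, ∀ C : Set Y, IsCompact C → C ⊆ B → C ∈ ℬ)

/-- `ℬ` witnesses that the ideal `𝒜` of compact subsets of `X` is closed under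
`𝒜`-unions: `ℬ` is an ideal of compact subsets of the subspace `𝔸 = 𝒜` of
`𝕂(X)` such that (i) for every `K₀ ∈ 𝒜`, `{K ∈ 𝔸 : K ⊆ K₀} ∈ ℬ`, and
(ii) for every `KK ∈ ℬ`, `⋃ KK ∈ 𝒜`. -/
def WitnessesAUnions {X : Type*} [TopologicalSpace X] (𝒜 : Set (Set X))
    (ℬ : Set (Set (ASub X 𝒜))) : Prop :=
  IsCompactIdealOn ℬ ∧
  (∀ K₀ ∈ 𝒜, {K : ASub X 𝒜 | K.1.1 ⊆ K₀} ∈ ℬ) ∧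
  (∀ KK ∈ ℬ, (⋃ K ∈ KK, (K : ASub X 𝒜).1.1) ∈ 𝒜)

/-- `X^{≤n}`: the disjoint union of `X, X², …, Xⁿ`. -/
abbrev LePow (X : Type*) (n : ℕ) := Σ i : Fin n, (Fin (i.1 + 1) → X)

/-- `X^{<ω}`: the disjoint union of all finite powers `Xⁿ`, `n ≥ 1`. -/
abbrev FinPows (X : Type*) := Σ n : ℕ, (Fin (n + 1) → X)

/-- `A^{≤n}`: the copy of the disjoint union of `A, A², …, Aⁿ` inside `X^{≤n}`. -/
def lePowSet {X : Type*} (n : ℕ) (A : Set X) : Set (LePow X n) :=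
  {p | ∀ j, p.2 j ∈ A}

/-- `A^{<ω}` inside `X^{<ω}`. -/
def finPowsSet {X : Type*} (A : Set X) : Set (FinPows X) :=
  {p | ∀ j, p.2 j ∈ A}

theorem IsOmegaCover.of_finite {Y : Type*} [TopologicalSpace Y] {𝒰 : Set (Set Y)}
    (ho : ∀ U ∈ 𝒰, IsOpen U) (hu : Set.univ ∉ 𝒰)
    (hf : ∀ F : Set Y, F.Finite → ∃ U ∈ 𝒰, F ⊆ U) : IsOmegaCover Y 𝒰 := by
  refine ⟨⟨ho, Set.eq_univ_of_forall fun y => ?_, hu⟩, hf⟩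
  obtain ⟨U, hU, hy⟩ := hf {y} (Set.finite_singleton y)
  exact ⟨U, hU, hy rfl⟩

section LePow

variable {X : Type*} {n : ℕ}

theorem lePowSet_univ : lePowSet n (Set.univ : Set X) = Set.univ :=
  Set.eq_univ_of_forall fun _ _ => Set.mem_univ _

theorem eq_univ_of_lePowSet_eq_univ (hn : 1 ≤ n) {A : Set X}
    (h : lePowSet n A = Set.univ) : A = Set.univ := by
  refine Set.eq_univ_of_forall fun x => ?_
  have hx : (⟨⟨0, hn⟩, fun _ => x⟩ : LePow X n) ∈ lePowSet n A := h ▸ Set.mem_univ _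
  exact hx 0

theorem finite_lePowSet {A : Set X} (hA : A.Finite) : (lePowSet n A).Finite := by
  have h : (⋃ i : Fin n, Sigma.mk i '' {f : Fin (i.1 + 1) → X | ∀ j, f j ∈ A}).Finite :=
    Set.finite_iUnion fun _ => (Set.Finite.pi' fun _ => hA).image _
  refine h.subset ?_
  rintro ⟨i, f⟩ hf
  exact Set.mem_iUnion.2 ⟨i, f, hf, rfl⟩

variable [TopologicalSpace X]

theorem isOpen_lePowSet {A : Set X} (hA : IsOpen A) : IsOpen (lePowSet n A) := by
  refine isOpen_sigma_iff.2 fun i => ?_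
  have h : IsOpen (⋂ j : Fin (i.1 + 1), (fun f : Fin (i.1 + 1) → X => f j) ⁻¹' A) :=
    isOpen_iInter_of_finite fun j => hA.preimage (continuous_apply j)
  convert h using 1
  ext f
  simp [lePowSet]

theorem IsOpen.exists_box_subset_lePow {U : Set (LePow X n)} (hU : IsOpen U)
    {p : LePow X n} (hp : p ∈ U) :
    ∃ W : Fin (p.1.1 + 1) → Set X, (∀ j, IsOpen (W j) ∧ p.2 j ∈ W j) ∧
      ∀ q : Fin (p.1.1 + 1) → X, (∀ j, q j ∈ W j) → (⟨p.1, q⟩ : LePow X n) ∈ U := by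
  obtain ⟨W, hW, hWU⟩ := isOpen_pi_iff'.1 (isOpen_sigma_iff.1 hU p.1) p.2 hp
  exact ⟨W, hW, fun q hq => hWU fun j _ => hq j⟩

/-- A tube lemma for finite sets in the bounded finite powers. -/
theorem exists_isOpen_lePowSet_subset {F : Set X} (hF : F.Finite)
    {U : Set (LePow X n)} (hU : IsOpen U) (hFU : lePowSet n F ⊆ U) :
    ∃ V, IsOpen V ∧ F ⊆ V ∧ lePowSet n V ⊆ U := by
  choose! W hW hWU using fun p (hp : p ∈ U) => hU.exists_box_subset_lePow hp
  refine ⟨⋃ x ∈ F, ⋂ p ∈ lePowSet n F, ⋂ j, ⋂ _ : p.2 j = x, W p j,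
    isOpen_biUnion fun x _ => (finite_lePowSet hF).isOpen_biInter fun p hp =>
      isOpen_iInter_of_finite fun j => isOpen_iInter_of_finite fun _ => (hW p (hFU hp) j).1,
    fun x hx => ?_, ?_⟩
  · simp only [Set.mem_iUnion, Set.mem_iInter]
    refine ⟨x, hx, fun p hp j hj => ?_⟩
    exact hj ▸ (hW p (hFU hp) j).2
  · rintro ⟨i, q⟩ hq
    simp only [lePowSet, Set.mem_ofPred_eq, Set.mem_iUnion, Set.mem_iInter] at hq
    choose x hxF hx using hq
    exact hWU ⟨i, x⟩ (hFU hxF) q fun j => hx j ⟨i, x⟩ hxF j rfl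

theorem IsOmegaCover.image_lePowSet (hn : 1 ≤ n) {𝒰 : Set (Set X)} (h : IsOmegaCover X 𝒰) :
    IsOmegaCover (LePow X n) ((fun U => lePowSet n U) '' 𝒰) := by
  refine .of_finite ?_ ?_ fun F hF => ?_
  · rintro _ ⟨U, hU, rfl⟩
    exact isOpen_lePowSet (h.1.1 U hU)
  · rintro ⟨U, hU, hUu⟩
    exact h.1.2.2 (eq_univ_of_lePowSet_eq_univ hn hUu ▸ hU)
  · obtain ⟨U, hU, hFU⟩ := h.2 (⋃ p ∈ F, Set.range p.2)
      (hF.biUnion fun p _ => Set.finite_range p.2)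
    exact ⟨_, ⟨U, hU, rfl⟩, fun p hp j => hFU (Set.mem_biUnion hp ⟨j, rfl⟩)⟩

theorem IsOmegaCover.of_lePow [Nonempty X] {𝒰 : Set (Set (LePow X n))}
    (h : IsOmegaCover (LePow X n) 𝒰) :
    IsOmegaCover X {V | V ∈ ProperNonemptyOpens X ∧ ∃ U ∈ 𝒰, lePowSet n V ⊆ U} := by
  refine .of_finite (fun V hV => hV.1.1) (fun hV => hV.1.2.2 rfl) fun F hF => ?_
  obtain ⟨x₀⟩ := ‹Nonempty X›
  have hF' : (insert x₀ F).Finite := hF.insert x₀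
  obtain ⟨U, hU, hFU⟩ := h.2 _ (finite_lePowSet (n := n) hF')
  obtain ⟨V, hVo, hFV, hVU⟩ := exists_isOpen_lePowSet_subset hF' (h.1.1 U hU) hFU
  refine ⟨V, ⟨⟨hVo, ⟨x₀, hFV (Set.mem_insert _ _)⟩, ?_⟩, U, hU, hVU⟩,
    (Set.subset_insert _ _).trans hFV⟩
  rintro rfl
  rw [lePowSet_univ, Set.univ_subset_iff] at hVU
  exact h.1.2.2 (hVU ▸ hU)

end LePow

/-- Lemma on `ω`-covers and the bounded finite powers `X^{≤n}`:
(a) if `𝒰` is an ω-cover of `X` then `{U^{≤n} : U ∈ 𝒰}` is an ω-cover of `X^{≤n}`;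
(b) if `𝒰` is an ω-cover of `X^{≤n}` then
`𝒱 = {V ∈ 𝒯_X : ∃ U ∈ 𝒰, V^{≤n} ⊆ U}` is an ω-cover of `X`. -/
theorem statement0 {X : Type*} [TopologicalSpace X] [T2Space X] [Infinite X]
    (n : ℕ) (hn : 1 ≤ n) :
    (∀ 𝒰 : Set (Set X), IsOmegaCover X 𝒰 →
      IsOmegaCover (LePow X n) ((fun U => lePowSet n U) '' 𝒰)) ∧
    (∀ 𝒰 : Set (Set (LePow X n)), IsOmegaCover (LePow X n) 𝒰 →
      IsOmegaCover X
        {V | V ∈ ProperNonemptyOpens X ∧ ∃ U ∈ 𝒰, lePowSet n V ⊆ U}) := by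
  exact ⟨fun _ h => h.image_lePowSet hn, fun _ h => h.of_lePow⟩
end

section
/- Let X be a Hausdorff space and let 𝒜 be an ideal of compact proper subsets of X (closed under finite unions and under compact subsets) with X = ⋃𝒜. Then G_fin(O(X,𝒜), O(X,𝒜)) ≤_II G_fin(O_X, O_X). -/
open Set

section FiniteUnions

variable {X : Type*}

/-- The family of all unions of finite subfamilies of `𝒰`. -/
def finiteUnions (𝒰 : Set (Set X)) : Set (Set X) :=
  {W | ∃ F ⊆ 𝒰, F.Finite ∧ ⋃₀ F = W}

lemma exists_finite_refinement (𝒰 S : Set (Set X)) :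
    ∃ G ⊆ 𝒰, G.Finite ∧ (Set.univ ∈ finiteUnions 𝒰 → ⋃₀ G = Set.univ) ∧
      (S.Finite → S ⊆ finiteUnions 𝒰 → ⋃₀ S ⊆ ⋃₀ G) := by
  by_cases hU : Set.univ ∈ finiteUnions 𝒰
  · obtain ⟨G, hG, hfin, hun⟩ := hU
    exact ⟨G, hG, hfin, fun _ => hun, fun _ _ => hun ▸ Set.subset_univ _⟩
  by_cases hS : S.Finite ∧ S ⊆ finiteUnions 𝒰
  · obtain ⟨hfin, hsub⟩ := hS
    have hsub' : ∀ W ∈ S, ∃ F ⊆ 𝒰, F.Finite ∧ ⋃₀ F = W := fun W hW => hsub hW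
    choose! G hG hGfin hGun using hsub'
    refine ⟨⋃ W ∈ S, G W, Set.iUnion₂_subset hG, hfin.biUnion hGfin,
      fun h => absurd h hU, fun _ _ => Set.sUnion_subset fun W hW => ?_⟩
    rw [← hGun W hW]
    exact Set.sUnion_subset_sUnion (Set.subset_biUnion_of_mem (u := G) hW)
  · exact ⟨∅, Set.empty_subset _, Set.finite_empty, fun h => absurd h hU,
      fun h₁ h₂ => absurd ⟨h₁, h₂⟩ hS⟩

/-- A finite subfamily of `𝒰` which covers the space if some finite subfamily does, and which
covers `⋃₀ S` if `S` is a finite set of finite unions of members of `𝒰`. -/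
noncomputable def finiteRefinement (𝒰 S : Set (Set X)) : Set (Set X) :=
  (exists_finite_refinement 𝒰 S).choose

lemma finiteRefinement_subset (𝒰 S : Set (Set X)) : finiteRefinement 𝒰 S ⊆ 𝒰 :=
  (exists_finite_refinement 𝒰 S).choose_spec.1

lemma finite_finiteRefinement (𝒰 S : Set (Set X)) : (finiteRefinement 𝒰 S).Finite :=
  (exists_finite_refinement 𝒰 S).choose_spec.2.1

lemma sUnion_finiteRefinement_eq_univ {𝒰 : Set (Set X)} (S : Set (Set X))
    (h : Set.univ ∈ finiteUnions 𝒰) : ⋃₀ finiteRefinement 𝒰 S = Set.univ :=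
  (exists_finite_refinement 𝒰 S).choose_spec.2.2.1 h

lemma sUnion_subset_sUnion_finiteRefinement {𝒰 S : Set (Set X)} (hfin : S.Finite)
    (hS : S ⊆ finiteUnions 𝒰) : ⋃₀ S ⊆ ⋃₀ finiteRefinement 𝒰 S :=
  (exists_finite_refinement 𝒰 S).choose_spec.2.2.2 hfin hS

/-- The history, in a game where One follows `σ`, of the moves of Two obtained by refining
successively the members of a given list. -/
noncomputable def refineHistory (σ : List (Set (Set X)) → Set (Set X))
    (h : List (Set (Set X))) : List (Set (Set X)) :=
  h.foldl (fun acc S => acc ++ [finiteRefinement (σ acc) S]) []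

lemma refineHistory_ofFn (σ : List (Set (Set X)) → Set (Set X)) (F : ℕ → Set (Set X)) (n : ℕ) :
    refineHistory σ (List.ofFn fun i : Fin n => F i) =
      List.ofFn fun i : Fin n =>
        finiteRefinement (σ (refineHistory σ (List.ofFn fun j : Fin i => F j))) (F i) := by
  induction n with
  | zero => rfl
  | succ n ih =>
    rw [List.ofFn_succ', List.ofFn_succ', List.concat_eq_append, List.concat_eq_append]
    simp only [Fin.val_castSucc, Fin.val_last]
    rw [← ih]
    simp [refineHistory, List.foldl_append]

variable [TopologicalSpace X]

lemma finiteUnions_mem_aCovers {𝒜 : Set (Set X)} (hA : ∀ A ∈ 𝒜, IsCompact A)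
    {𝒰 : Set (Set X)} (hU : 𝒰 ∈ openCovers X) (hfin : Set.univ ∉ finiteUnions 𝒰) :
    finiteUnions 𝒰 ∈ aCovers X 𝒜 := by
  obtain ⟨hopen, hun, -⟩ := hU
  refine ⟨⟨?_, ?_, hfin⟩, fun A hAmem => ?_⟩
  · rintro _ ⟨F, hF, -, rfl⟩
    exact isOpen_sUnion fun U hU => hopen U (hF hU)
  · refine Set.eq_univ_of_univ_subset (hun ▸ Set.sUnion_subset_sUnion fun U hU => ?_)
    exact ⟨{U}, Set.singleton_subset_iff.2 hU, Set.finite_singleton U, Set.sUnion_singleton U⟩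
  · obtain ⟨T, hT, hTfin, hAT⟩ := (hA A hAmem).elim_finite_subcover_image (c := id) hopen
      (by simp only [id, ← Set.sUnion_eq_biUnion, hun, Set.subset_univ])
    exact ⟨⋃₀ T, ⟨T, hT, hTfin, rfl⟩, by rwa [Set.sUnion_eq_biUnion]⟩

lemma iUnion_mem_openCovers {a G : ℕ → Set (Set X)} (ha : ∀ n, a n ∈ openCovers X)
    (hG : ∀ n, G n ⊆ a n) (hun : ⋃₀ (⋃ n, G n) = Set.univ) :
    (⋃ n, G n) ∈ openCovers X := by
  refine ⟨fun U hU => ?_, hun, fun hU => ?_⟩ <;> obtain ⟨n, hn⟩ := Set.mem_iUnion.1 hU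
  · exact (ha n).1 U (hG n hn)
  · exact (ha n).2.2 (hG n hn)

lemma iUnion_finiteRefinement_mem_openCovers_of_univ_mem {a : ℕ → Set (Set X)}
    (ha : ∀ n, a n ∈ openCovers X) (S : ℕ → Set (Set X)) {m : ℕ}
    (hm : Set.univ ∈ finiteUnions (a m)) :
    (⋃ n, finiteRefinement (a n) (S n)) ∈ openCovers X := by
  refine iUnion_mem_openCovers ha (fun n => finiteRefinement_subset _ _)
    (Set.eq_univ_of_univ_subset ?_)
  rw [← sUnion_finiteRefinement_eq_univ (S m) hm]
  exact Set.sUnion_subset_sUnion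
    (Set.subset_iUnion (fun n => finiteRefinement (a n) (S n)) m)

lemma iUnion_finiteRefinement_mem_openCovers {𝒜 : Set (Set X)} {a S : ℕ → Set (Set X)}
    (ha : ∀ n, a n ∈ openCovers X) (hS : ∀ n, S n ⊆ finiteUnions (a n) ∧ (S n).Finite)
    (hcov : (⋃ n, S n) ∈ aCovers X 𝒜) :
    (⋃ n, finiteRefinement (a n) (S n)) ∈ openCovers X := by
  refine iUnion_mem_openCovers ha (fun n => finiteRefinement_subset _ _)
    (Set.eq_univ_of_univ_subset ?_)
  rw [← hcov.1.2.1, Set.sUnion_iUnion, Set.sUnion_iUnion]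
  exact Set.iUnion_mono fun n => sUnion_subset_sUnion_finiteRefinement (hS n).2 (hS n).1

variable {𝒜 : Set (Set X)}

lemma twoMarkovFin_openCovers (hA : ∀ A ∈ 𝒜, IsCompact A)
    (h : TwoMarkovFin (aCovers X 𝒜) (aCovers X 𝒜)) :
    TwoMarkovFin (openCovers X) (openCovers X) := by
  obtain ⟨τ, hτ⟩ := h
  refine ⟨fun 𝒰 n => finiteRefinement 𝒰 (τ (finiteUnions 𝒰) n), fun a ha =>
    ⟨fun n => ⟨finiteRefinement_subset _ _, finite_finiteRefinement _ _⟩, ?_⟩⟩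
  by_cases hm : ∃ m, Set.univ ∈ finiteUnions (a m)
  · obtain ⟨m, hm⟩ := hm
    exact iUnion_finiteRefinement_mem_openCovers_of_univ_mem ha _ hm
  · push Not at hm
    obtain ⟨hlegal, hwin⟩ := hτ (fun n => finiteUnions (a n))
      fun n => finiteUnions_mem_aCovers hA (ha n) (hm n)
    exact iUnion_finiteRefinement_mem_openCovers ha hlegal hwin

lemma twoWinFin_openCovers (hA : ∀ A ∈ 𝒜, IsCompact A)
    (h : TwoWinFin (aCovers X 𝒜) (aCovers X 𝒜)) :
    TwoWinFin (openCovers X) (openCovers X) := by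
  obtain ⟨τ, hτ⟩ := h
  let τ' : List (Set (Set X)) → Set (Set X) :=
    fun l => finiteRefinement (l.getLastD ∅) (τ (l.map finiteUnions))
  have hτ' (a : ℕ → Set (Set X)) (n : ℕ) : τ' (List.ofFn fun i : Fin (n + 1) => a i) =
      finiteRefinement (a n) (τ (List.ofFn fun i : Fin (n + 1) => finiteUnions (a i))) := by
    have hlast : (List.ofFn fun i : Fin (n + 1) => a i).getLastD ∅ = a n := by
      rw [List.ofFn_succ', List.concat_eq_append]
      simp
    simp only [τ', hlast, List.map_ofFn]
    rfl
  refine ⟨τ', fun a ha => ?_⟩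
  simp only [hτ']
  refine ⟨fun n => ⟨finiteRefinement_subset _ _, finite_finiteRefinement _ _⟩, ?_⟩
  by_cases hm : ∃ m, Set.univ ∈ finiteUnions (a m)
  · obtain ⟨m, hm⟩ := hm
    exact iUnion_finiteRefinement_mem_openCovers_of_univ_mem ha _ hm
  · push Not at hm
    obtain ⟨hlegal, hwin⟩ := hτ (fun n => finiteUnions (a n))
      fun n => finiteUnions_mem_aCovers hA (ha n) (hm n)
    exact iUnion_finiteRefinement_mem_openCovers ha hlegal hwin

lemma oneWinFin_aCovers (hA : ∀ A ∈ 𝒜, IsCompact A)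
    (h : OneWinFin (openCovers X) (openCovers X)) :
    OneWinFin (aCovers X 𝒜) (aCovers X 𝒜) := by
  obtain ⟨σ, hσ, hwin⟩ := h
  have hlose (F : ℕ → Set (Set X)) :
      (⋃ n, finiteRefinement (σ (refineHistory σ (List.ofFn fun i : Fin n => F i))) (F n)) ∉
        openCovers X := by
    refine hwin _ fun n => ?_
    rw [← refineHistory_ofFn]
    exact ⟨finiteRefinement_subset _ _, finite_finiteRefinement _ _⟩
  refine ⟨fun l => finiteUnions (σ (refineHistory σ l)), fun l =>
    finiteUnions_mem_aCovers hA (hσ _) fun hl => ?_, fun F hF hcov => ?_⟩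
  · refine hlose (fun k => l.getD k ∅)
      (iUnion_finiteRefinement_mem_openCovers_of_univ_mem (m := l.length) (fun _ => hσ _) _ ?_)
    have hl' : (List.ofFn fun i : Fin l.length => l.getD i ∅) = l := by simp
    rwa [hl']
  · exact hlose F (iUnion_finiteRefinement_mem_openCovers (fun _ => hσ _) hF hcov)

lemma onePreFin_aCovers (hA : ∀ A ∈ 𝒜, IsCompact A)
    (h : OnePreFin (openCovers X) (openCovers X)) :
    OnePreFin (aCovers X 𝒜) (aCovers X 𝒜) := by
  obtain ⟨σ, hσ, hwin⟩ := h
  have hlose (F : ℕ → Set (Set X)) : (⋃ n, finiteRefinement (σ n) (F n)) ∉ openCovers X :=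
    hwin _ fun n => ⟨finiteRefinement_subset _ _, finite_finiteRefinement _ _⟩
  exact ⟨fun n => finiteUnions (σ n), fun n => finiteUnions_mem_aCovers hA (hσ n) fun hn =>
      hlose (fun _ => ∅) (iUnion_finiteRefinement_mem_openCovers_of_univ_mem hσ _ hn),
    fun F hF hcov => hlose F (iUnion_finiteRefinement_mem_openCovers hσ hF hcov)⟩

lemma oneConstFin_aCovers (hA : ∀ A ∈ 𝒜, IsCompact A)
    (h : OneConstFin (openCovers X) (openCovers X)) :
    OneConstFin (aCovers X 𝒜) (aCovers X 𝒜) := by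
  obtain ⟨𝒰, hU, hwin⟩ := h
  have hlose (F : ℕ → Set (Set X)) : (⋃ n, finiteRefinement 𝒰 (F n)) ∉ openCovers X :=
    hwin _ fun n => ⟨finiteRefinement_subset _ _, finite_finiteRefinement _ _⟩
  exact ⟨finiteUnions 𝒰, finiteUnions_mem_aCovers hA hU fun hn => hlose (fun _ => ∅)
      (iUnion_finiteRefinement_mem_openCovers_of_univ_mem (m := 0) (fun _ => hU) _ hn),
    fun F hF hcov => hlose F (iUnion_finiteRefinement_mem_openCovers (fun _ => hU) hF hcov)⟩

end FiniteUnions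

/-- If `𝒜` is an ideal of compact proper subsets of a Hausdorff space `X` with
`X = ⋃𝒜`, then `G_fin(O(X,𝒜), O(X,𝒜)) ≤_II G_fin(O_X, O_X)`. -/
theorem statement1 {X : Type*} [TopologicalSpace X] [T2Space X]
    (𝒜 : Set (Set X)) (hIdeal : IsCompactIdealOn 𝒜) (hcov : ⋃₀ 𝒜 = Set.univ) :
    LeTwoFin (aCovers X 𝒜) (aCovers X 𝒜) (openCovers X) (openCovers X) := by
  have hA : ∀ A ∈ 𝒜, IsCompact A := fun A h => (hIdeal.1 A h).1
  exact ⟨twoMarkovFin_openCovers hA, twoWinFin_openCovers hA, mt (oneWinFin_aCovers hA),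
    mt (onePreFin_aCovers hA), mt (oneConstFin_aCovers hA)⟩
end

section
/- For any infinite Hausdorff space X, any n ≥ 1, and □ ∈ {1, fin}: G_□(Ω_X, Ω_X) ≡ G_□(Ω_{Xⁿ}, Ω_{Xⁿ}) ≡ G_□(Ω_{X^{<ω}}, Ω_{X^{<ω}}) ≡ G_□(O_{X^{<ω}}, O_{X^{<ω}}). -/
open Set

/-- An abstract game of length `ω`: One plays elements of `moves`, Two answers with legal
responses, and Two wins when the sequence of responses satisfies `win`. -/
structure SelectionGame (α β : Type*) where
  moves : Set α
  legal : α → β → Prop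
  win : (ℕ → β) → Prop

namespace SelectionGame

variable {α β α' β' : Type*}

/-- Two has a winning Markov strategy. -/
def TwoMarkov (G : SelectionGame α β) : Prop :=
  ∃ τ : α → ℕ → β, ∀ a : ℕ → α, (∀ n, a n ∈ G.moves) →
    (∀ n, G.legal (a n) (τ (a n) n)) ∧ G.win fun n => τ (a n) n

/-- Two has a winning strategy. -/
def TwoWin (G : SelectionGame α β) : Prop :=
  ∃ τ : List α → β, ∀ a : ℕ → α, (∀ n, a n ∈ G.moves) →
    (∀ n, G.legal (a n) (τ (List.ofFn fun i : Fin (n + 1) => a i))) ∧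
    G.win fun n => τ (List.ofFn fun i : Fin (n + 1) => a i)

/-- One has a winning strategy. -/
def OneWin (G : SelectionGame α β) : Prop :=
  ∃ σ : List β → α, (∀ h, σ h ∈ G.moves) ∧
    ∀ x : ℕ → β, (∀ n, G.legal (σ (List.ofFn fun i : Fin n => x i)) (x n)) → ¬ G.win x

/-- One has a winning predetermined strategy. -/
def OnePre (G : SelectionGame α β) : Prop :=
  ∃ σ : ℕ → α, (∀ n, σ n ∈ G.moves) ∧ ∀ x : ℕ → β, (∀ n, G.legal (σ n) (x n)) → ¬ G.win x

/-- One has a winning constant strategy. -/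
def OneConst (G : SelectionGame α β) : Prop :=
  ∃ a ∈ G.moves, ∀ x : ℕ → β, (∀ n, G.legal a (x n)) → ¬ G.win x

theorem foldl_ofFn_succ {γ S : Type*} (f : S → γ → S) (s : S) (a : ℕ → γ) (n : ℕ) :
    (List.ofFn fun i : Fin (n + 1) => a i).foldl f s =
      f ((List.ofFn fun i : Fin n => a i).foldl f s) (a n) := by
  rw [List.ofFn_succ']
  simp [List.concat_eq_append, List.foldl_append]

theorem eq_ofFn_of_append {γ : Type*} {l : ℕ → List γ} {f : ℕ → γ} (h₀ : l 0 = [])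
    (hs : ∀ n, l (n + 1) = l n ++ [f n]) (n : ℕ) : l n = List.ofFn fun i : Fin n => f i := by
  induction n with
  | zero => simpa using h₀
  | succ n ih =>
    rw [hs, ih, List.ofFn_succ']
    simp [List.concat_eq_append]

/-- Two wins if she can win by an automaton with state space `S`. -/
theorem twoWin_of_automaton [Inhabited β] {G : SelectionGame α β} {S : Type*} (s₀ : S)
    (out : S → α → β) (next : S → α → S)
    (h : ∀ (a : ℕ → α) (s : ℕ → S), (∀ n, a n ∈ G.moves) → s 0 = s₀ →
      (∀ n, s (n + 1) = next (s n) (a n)) →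
      (∀ n, G.legal (a n) (out (s n) (a n))) ∧ G.win fun n => out (s n) (a n)) : G.TwoWin := by
  refine ⟨fun L => (L.foldl (fun p a => (next p.1 a, out p.1 a)) (s₀, default)).2,
    fun a ha => ?_⟩
  simp only [foldl_ofFn_succ]
  refine h a (fun n => ((List.ofFn fun i : Fin n => a i).foldl
    (fun p a => (next p.1 a, out p.1 a)) (s₀, default)).1) ha (by simp) fun n => ?_
  simp only [foldl_ofFn_succ]

/-- One wins if he can win by an automaton with state space `S`. -/
theorem oneWin_of_automaton {G : SelectionGame α β} {S : Type*} (s₀ : S)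
    (out : S → α) (next : S → β → S) (hout : ∀ s, out s ∈ G.moves)
    (h : ∀ (x : ℕ → β) (s : ℕ → S), s 0 = s₀ → (∀ n, s (n + 1) = next (s n) (x n)) →
      (∀ n, G.legal (out (s n)) (x n)) → ¬ G.win x) : G.OneWin :=
  ⟨fun L => out (L.foldl next s₀), fun _ => hout _, fun x hx =>
    h x (fun n => (List.ofFn fun i : Fin n => x i).foldl next s₀) (by simp)
      (fun n => foldl_ofFn_succ _ _ _ _) hx⟩

/-- A round-by-round translation of One's moves in `H` to `G` and of Two's responses in `G`
back to `H` which preserves wins of Two. -/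
structure Translation (G : SelectionGame α β) (H : SelectionGame α' β') where
  one : ℕ → α' → α
  two : ℕ → α' → β → β'
  one_mem : ∀ n, ∀ a ∈ H.moves, one n a ∈ G.moves
  two_legal : ∀ n, ∀ a ∈ H.moves, ∀ x, G.legal (one n a) x → H.legal a (two n a x)
  win : ∀ (a : ℕ → α') (x : ℕ → β), (∀ n, a n ∈ H.moves) →
    (∀ n, G.legal (one n (a n)) (x n)) → G.win x → H.win fun n => two n (a n) (x n)

namespace Translation

variable {G : SelectionGame α β} {H : SelectionGame α' β'}

theorem twoMarkov (T : Translation G H) : G.TwoMarkov → H.TwoMarkov := by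
  rintro ⟨τ, hτ⟩
  refine ⟨fun a n => T.two n a (τ (T.one n a) n), fun a ha => ?_⟩
  obtain ⟨h₁, h₂⟩ := hτ (fun n => T.one n (a n)) fun n => T.one_mem n _ (ha n)
  exact ⟨fun n => T.two_legal n _ (ha n) _ (h₁ n), T.win a _ ha h₁ h₂⟩

theorem twoWin [Inhabited β'] (T : Translation G H) : G.TwoWin → H.TwoWin := by
  rintro ⟨τ, hτ⟩
  refine twoWin_of_automaton (S := List α) []
    (fun s a => T.two s.length a (τ (s ++ [T.one s.length a])))
    (fun s a => s ++ [T.one s.length a]) fun a s ha h₀ hs => ?_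
  have hlen : ∀ n, (s n).length = n := fun n => by
    induction n with
    | zero => simp [h₀]
    | succ n ih => simp [hs, ih]
  simp only [hlen] at hs ⊢
  obtain ⟨h₁, h₂⟩ := hτ (fun n => T.one n (a n)) fun n => T.one_mem n _ (ha n)
  have hofFn : ∀ n, s n ++ [T.one n (a n)] = List.ofFn fun i : Fin (n + 1) => T.one i (a i) :=
    fun n => by rw [← hs, eq_ofFn_of_append h₀ hs]
  simp only [hofFn]
  exact ⟨fun n => T.two_legal n _ (ha n) _ (h₁ n), T.win a _ ha h₁ h₂⟩

theorem oneWin (T : Translation G H) : H.OneWin → G.OneWin := by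
  rintro ⟨σ, hσ, hw⟩
  refine oneWin_of_automaton (S := List β') [] (fun l => T.one l.length (σ l))
    (fun l x => l ++ [T.two l.length (σ l) x]) (fun l => T.one_mem _ _ (hσ _))
    fun x l h₀ hl hx hwin => ?_
  have hlen : ∀ n, (l n).length = n := fun n => by
    induction n with
    | zero => simp [h₀]
    | succ n ih => simp [hl, ih]
  simp only [hlen] at hl hx
  have hofFn := eq_ofFn_of_append h₀ hl
  refine hw (fun n => T.two n (σ (l n)) (x n)) (fun n => ?_)
    (T.win (fun n => σ (l n)) x (fun n => hσ _) hx hwin)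
  rw [← hofFn n]
  exact T.two_legal n _ (hσ _) _ (hx n)

theorem onePre (T : Translation G H) : H.OnePre → G.OnePre := by
  rintro ⟨σ, hσ, hw⟩
  exact ⟨fun n => T.one n (σ n), fun n => T.one_mem n _ (hσ n), fun x hx hwin =>
    hw _ (fun n => T.two_legal n _ (hσ n) _ (hx n)) (T.win σ x hσ hx hwin)⟩

theorem oneConst (T : Translation G H) (hT : ∀ n, T.one n = T.one 0) :
    H.OneConst → G.OneConst := by
  rintro ⟨a, ha, hw⟩
  refine ⟨T.one 0 a, T.one_mem 0 _ ha, fun x hx hwin => ?_⟩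
  have hx' : ∀ n, G.legal (T.one n a) (x n) := fun n => by rw [hT]; exact hx n
  exact hw _ (fun n => T.two_legal n _ ha _ (hx' n)) (T.win (fun _ => a) x (fun _ => ha) hx' hwin)

end Translation

/-- The single-selection game `G_1(A, B)`. -/
def single {ι : Type*} (A B : Set (Set ι)) : SelectionGame (Set ι) ι where
  moves := A
  legal a x := x ∈ a
  win x := Set.range x ∈ B

/-- The finite-selection game `G_fin(A, B)`. -/
def finite {ι : Type*} (A B : Set (Set ι)) : SelectionGame (Set ι) (Set ι) where
  moves := A
  legal a F := F ⊆ a ∧ F.Finite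
  win F := (⋃ n, F n) ∈ B

end SelectionGame

open SelectionGame

section Translations

variable {ι κ : Type*} {A C : Set (Set ι)} {B D : Set (Set κ)}

/-- A translation between selection games acting on the individual selections of Two. -/
structure SelectionTranslation (A C : Set (Set ι)) (B D : Set (Set κ)) where
  one : ℕ → Set κ → Set ι
  two : ℕ → Set κ → ι → κ
  one_mem : ∀ n, ∀ b ∈ B, one n b ∈ A
  two_mem : ∀ n, ∀ b ∈ B, ∀ x ∈ one n b, two n b x ∈ b
  win : ∀ (b : ℕ → Set κ) (P : ℕ → Set ι), (∀ n, b n ∈ B) →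
    (∀ n, P n ⊆ one n (b n) ∧ (P n).Finite) → (⋃ n, P n) ∈ C →
    (⋃ n, two n (b n) '' P n) ∈ D

namespace SelectionTranslation

/-- The induced translation of single-selection games. -/
def toSingle (T : SelectionTranslation A C B D) : Translation (single A C) (single B D) where
  one := T.one
  two := T.two
  one_mem := T.one_mem
  two_legal := T.two_mem
  win b x hb hx hwin := by
    have h := T.win b (fun n => {x n}) hb
      (fun n => ⟨Set.singleton_subset_iff.2 (hx n), Set.finite_singleton _⟩)
      (by rwa [Set.iUnion_singleton_eq_range])
    simp only [Set.image_singleton, Set.iUnion_singleton_eq_range] at h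
    exact h

/-- The induced translation of finite-selection games. -/
def toFinite (T : SelectionTranslation A C B D) : Translation (finite A C) (finite B D) where
  one := T.one
  two n b F := T.two n b '' F
  one_mem := T.one_mem
  two_legal n b hb _ hF :=
    ⟨Set.image_subset_iff.2 fun x hx => T.two_mem n b hb x (hF.1 hx), hF.2.image _⟩
  win := T.win

theorem leTwo1 [Inhabited κ] (T : SelectionTranslation A C B D)
    (hc : OneConst1 B D → OneConst1 A C) : LeTwo1 A C B D :=
  ⟨T.toSingle.twoMarkov, T.toSingle.twoWin, mt T.toSingle.oneWin, mt T.toSingle.onePre, mt hc⟩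

theorem leTwoFin (T : SelectionTranslation A C B D)
    (hc : OneConstFin B D → OneConstFin A C) : LeTwoFin A C B D :=
  ⟨T.toFinite.twoMarkov, T.toFinite.twoWin, mt T.toFinite.oneWin, mt T.toFinite.onePre, mt hc⟩

end SelectionTranslation

theorem not_oneConst1_iff (hC : ∀ c ∈ C, c.Nonempty) :
    ¬ OneConst1 A C ↔ ∀ a ∈ A, ∃ c ⊆ a, c.Countable ∧ c ∈ C := by
  simp only [OneConst1, not_exists, not_and, not_forall, not_not]
  refine forall₂_congr fun a _ => ⟨?_, ?_⟩
  · rintro ⟨x, hx, hC⟩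
    exact ⟨_, Set.range_subset_iff.2 hx, Set.countable_range x, hC⟩
  · rintro ⟨c, hca, hc, hcC⟩
    obtain ⟨x, rfl⟩ := hc.exists_eq_range (hC c hcC)
    exact ⟨x, fun n => hca ⟨n, rfl⟩, hcC⟩

theorem not_oneConstFin_iff (hC : ∀ c ∈ C, c.Nonempty) :
    ¬ OneConstFin A C ↔ ∀ a ∈ A, ∃ c ⊆ a, c.Countable ∧ c ∈ C := by
  simp only [OneConstFin, not_exists, not_and, not_forall, not_not]
  refine forall₂_congr fun a _ => ⟨?_, ?_⟩
  · rintro ⟨F, hF, hC⟩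
    exact ⟨_, Set.iUnion_subset fun n => (hF n).1,
      Set.countable_iUnion fun n => (hF n).2.countable, hC⟩
  · rintro ⟨c, hca, hc, hcC⟩
    obtain ⟨x, rfl⟩ := hc.exists_eq_range (hC c hcC)
    refine ⟨fun n => {x n}, fun n => ⟨?_, Set.finite_singleton _⟩, ?_⟩
    · exact Set.singleton_subset_iff.2 (hca ⟨n, rfl⟩)
    · rwa [Set.iUnion_singleton_eq_range]

theorem oneConst1_iff_oneConstFin (hC : ∀ c ∈ C, c.Nonempty) :
    OneConst1 A C ↔ OneConstFin A C :=
  not_iff_not.1 ((not_oneConst1_iff hC).trans (not_oneConstFin_iff hC).symm)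

theorem Equiv1.of_le (h : LeTwo1 A C B D) (h' : LeTwo1 B D A C) : Equiv1 A C B D :=
  ⟨⟨h.1, h'.1⟩, ⟨h.2.1, h'.2.1⟩, not_iff_not.1 ⟨h.2.2.1, h'.2.2.1⟩,
    not_iff_not.1 ⟨h.2.2.2.1, h'.2.2.2.1⟩, not_iff_not.1 ⟨h.2.2.2.2, h'.2.2.2.2⟩⟩

theorem EquivFin.of_le (h : LeTwoFin A C B D) (h' : LeTwoFin B D A C) : EquivFin A C B D :=
  ⟨⟨h.1, h'.1⟩, ⟨h.2.1, h'.2.1⟩, not_iff_not.1 ⟨h.2.2.1, h'.2.2.1⟩,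
    not_iff_not.1 ⟨h.2.2.2.1, h'.2.2.2.1⟩, not_iff_not.1 ⟨h.2.2.2.2, h'.2.2.2.2⟩⟩

theorem LeTwo1.trans {μ : Type*} {E F : Set (Set μ)} (h : LeTwo1 A C B D)
    (h' : LeTwo1 B D E F) : LeTwo1 A C E F :=
  ⟨h'.1 ∘ h.1, h'.2.1 ∘ h.2.1, h'.2.2.1 ∘ h.2.2.1, h'.2.2.2.1 ∘ h.2.2.2.1,
    h'.2.2.2.2 ∘ h.2.2.2.2⟩

theorem LeTwoFin.trans {μ : Type*} {E F : Set (Set μ)} (h : LeTwoFin A C B D)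
    (h' : LeTwoFin B D E F) : LeTwoFin A C E F :=
  ⟨h'.1 ∘ h.1, h'.2.1 ∘ h.2.1, h'.2.2.1 ∘ h.2.2.1, h'.2.2.2.1 ∘ h.2.2.2.1,
    h'.2.2.2.2 ∘ h.2.2.2.2⟩

end Translations

section OmegaCovers

variable {X Z : Type*} [TopologicalSpace X] [TopologicalSpace Z]

theorem isOmegaCover_iff {𝒰 : Set (Set X)} : IsOmegaCover X 𝒰 ↔
    (∀ U ∈ 𝒰, IsOpen U) ∧ Set.univ ∉ 𝒰 ∧ ∀ F : Set X, F.Finite → ∃ U ∈ 𝒰, F ⊆ U := by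
  refine ⟨fun h => ⟨h.1.1, h.1.2.2, h.2⟩, fun ⟨ho, hu, hF⟩ => ⟨⟨ho, ?_, hu⟩, hF⟩⟩
  refine Set.eq_univ_of_forall fun x => ?_
  obtain ⟨U, hU, hx⟩ := hF {x} (Set.finite_singleton x)
  exact ⟨U, hU, Set.singleton_subset_iff.1 hx⟩

theorem IsNontrivialOpenCover.exists_mem {𝒰 : Set (Set X)} (h : IsNontrivialOpenCover X 𝒰)
    (x : X) : ∃ U ∈ 𝒰, x ∈ U :=
  Set.mem_sUnion.1 (h.2.1 ▸ Set.mem_univ x)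

theorem nonempty_of_mem_omegaCovers : ∀ 𝒰 ∈ omegaCovers X, 𝒰.Nonempty := fun _ h =>
  let ⟨U, hU, _⟩ := h.2 ∅ Set.finite_empty
  ⟨U, hU⟩

theorem nonempty_of_mem_openCovers [Nonempty X] : ∀ 𝒰 ∈ openCovers X, 𝒰.Nonempty :=
  fun _ h =>
    let ⟨U, hU, _⟩ := IsNontrivialOpenCover.exists_mem h (Classical.arbitrary X)
    ⟨U, hU⟩

theorem omegaCovers_nonempty [T1Space X] [Infinite X] : (omegaCovers X).Nonempty := by
  refine ⟨{U | IsOpen U ∧ U ≠ Set.univ}, isOmegaCover_iff.2 ⟨fun U hU => hU.1, fun h => h.2 rfl,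
    fun F hF => ?_⟩⟩
  obtain ⟨x, hx⟩ := hF.exists_notMem
  exact ⟨{x}ᶜ, ⟨isOpen_compl_singleton, fun h => by simpa using h.ge (Set.mem_univ x)⟩,
    Set.subset_compl_singleton_iff.2 hx⟩

/-- `Z` behaves like a finite power of `X`, or like the union of all finite powers: `cube A` is
the power of `A` in `Z`, and `trunc k A` is its part of bounded dimension. -/
structure IsFinitePower (cube : Set X → Set Z) (trunc : ℕ → Set X → Set Z) : Prop where
  isOpen_cube : ∀ U, IsOpen U → IsOpen (cube U)
  cube_mono : Monotone cube
  trunc_mono : ∀ k, Monotone (trunc k)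
  trunc_subset : ∀ k A, trunc k A ⊆ cube A
  trunc_finite : ∀ k F, F.Finite → (trunc k F).Finite
  tube : ∀ k F W, F.Finite → IsOpen W → trunc k F ⊆ W → ∃ U, IsOpen U ∧ F ⊆ U ∧ trunc k U ⊆ W
  exhaust : ∀ G : Set Z, G.Finite → ∃ F : Set X, F.Finite ∧ ∃ m, ∀ k, m ≤ k → G ⊆ trunc k F
  diag : ∃ d : X → Z, ∀ x A, d x ∈ cube A ↔ x ∈ A

namespace IsFinitePower

variable {cube : Set X → Set Z} {trunc : ℕ → Set X → Set Z}

theorem cube_ne_univ (h : IsFinitePower cube trunc) {U : Set X} (hU : U ≠ Set.univ) :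
    cube U ≠ Set.univ := by
  obtain ⟨d, hd⟩ := h.diag
  obtain ⟨x, hx⟩ := (Set.ne_univ_iff_exists_notMem U).1 hU
  exact fun hc => hx ((hd x U).1 (hc ▸ Set.mem_univ _))

theorem image_cube_mem_omegaCovers (h : IsFinitePower cube trunc) {𝒰 : Set (Set X)}
    (h𝒰 : 𝒰 ∈ omegaCovers X) : cube '' 𝒰 ∈ omegaCovers Z := by
  refine isOmegaCover_iff.2 ⟨?_, ?_, fun G hG => ?_⟩
  · rintro _ ⟨U, hU, rfl⟩
    exact h.isOpen_cube U (h𝒰.1.1 U hU)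
  · rintro ⟨U, hU, hc⟩
    exact h.cube_ne_univ (fun hu => h𝒰.1.2.2 (hu ▸ hU)) hc
  · obtain ⟨F, hF, m, hm⟩ := h.exhaust G hG
    obtain ⟨U, hU, hFU⟩ := h𝒰.2 F hF
    exact ⟨cube U, ⟨U, hU, rfl⟩,
      (hm m le_rfl).trans ((h.trunc_subset m F).trans (h.cube_mono hFU))⟩

/-- A cover of `X` whose cubes form an ω-cover is an ω-cover. -/
theorem mem_omegaCovers_of_image_cube (h : IsFinitePower cube trunc) {𝒰 : Set (Set X)}
    (ho : ∀ U ∈ 𝒰, IsOpen U) (hu : Set.univ ∉ 𝒰) (hc : cube '' 𝒰 ∈ omegaCovers Z) :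
    𝒰 ∈ omegaCovers X := by
  refine isOmegaCover_iff.2 ⟨ho, hu, fun F hF => ?_⟩
  obtain ⟨d, hd⟩ := h.diag
  obtain ⟨_, ⟨U, hU, rfl⟩, hFU⟩ := hc.2 (d '' F) (hF.image d)
  exact ⟨U, hU, fun x hx => (hd x U).1 (hFU ⟨x, hx, rfl⟩)⟩

/-- The translation replacing a cover of `X` by the cover of `Z` consisting of its cubes. -/
noncomputable def cubeTranslation (cube : Set X → Set Z) {𝒞 : Set (Set (Set Z))}
    (h₁ : ∀ 𝒰 ∈ omegaCovers X, cube '' 𝒰 ∈ 𝒞)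
    (h₂ : ∀ 𝒰 : Set (Set X), (∀ U ∈ 𝒰, IsOpen U) → Set.univ ∉ 𝒰 → cube '' 𝒰 ∈ 𝒞 →
      𝒰 ∈ omegaCovers X) :
    SelectionTranslation 𝒞 𝒞 (omegaCovers X) (omegaCovers X) where
  one _ 𝒰 := cube '' 𝒰
  two _ 𝒰 := Function.invFunOn cube 𝒰
  one_mem _ := h₁
  two_mem _ _ _ _ hW := Function.invFunOn_mem hW
  win 𝒰 P h𝒰 hP hwin := by
    have hmem : ∀ n, ∀ W ∈ P n, Function.invFunOn cube (𝒰 n) W ∈ 𝒰 n := fun n W hW =>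
      Function.invFunOn_mem ((hP n).1 hW)
    refine h₂ _ ?_ ?_ ?_
    · intro U hU
      obtain ⟨n, W, hW, rfl⟩ := Set.mem_iUnion.1 hU
      exact (h𝒰 n).1.1 _ (hmem n W hW)
    · intro hU
      obtain ⟨n, W, hW, hu⟩ := Set.mem_iUnion.1 hU
      exact (h𝒰 n).1.2.2 (hu ▸ hmem n W hW)
    · convert hwin
      rw [Set.image_iUnion]
      refine Set.iUnion_congr fun n => ?_
      rw [Set.image_image]
      exact (Set.image_congr fun W hW => Function.invFunOn_eq ((hP n).1 hW)).trans (Set.image_id _)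

/-- The proper open sets whose `k`-th truncated power refines `𝒲`. -/
def truncRefinement (trunc : ℕ → Set X → Set Z) (k : ℕ) (𝒲 : Set (Set Z)) : Set (Set X) :=
  {U | IsOpen U ∧ U ≠ Set.univ ∧ ∃ W ∈ 𝒲, trunc k U ⊆ W}

theorem truncRefinement_mem_omegaCovers [T1Space X] [Infinite X]
    (h : IsFinitePower cube trunc) (k : ℕ) {𝒲 : Set (Set Z)} (h𝒲 : 𝒲 ∈ omegaCovers Z) :
    truncRefinement trunc k 𝒲 ∈ omegaCovers X := by
  refine isOmegaCover_iff.2 ⟨fun U hU => hU.1, fun hU => hU.2.1 rfl, fun F hF => ?_⟩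
  obtain ⟨W, hW, hFW⟩ := h𝒲.2 _ (h.trunc_finite k F hF)
  obtain ⟨U, hUo, hFU, hUW⟩ := h.tube k F W hF (h𝒲.1.1 W hW) hFW
  obtain ⟨x, hx⟩ := hF.exists_notMem
  refine ⟨U \ {x}, ⟨hUo.sdiff isClosed_singleton, fun hc => ?_, W, hW,
    (h.trunc_mono k Set.sdiff_subset).trans hUW⟩, Set.subset_sdiff_singleton hFU hx⟩
  exact (hc.ge (Set.mem_univ x)).2 rfl

omit [TopologicalSpace Z] in
theorem exists_refinement_choice {trunc : ℕ → Set X → Set Z} {k : ℕ} {𝒲 : Set (Set Z)}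
    {U : Set X} (hU : U ∈ truncRefinement trunc k 𝒲) :
    Classical.epsilon (fun W => W ∈ 𝒲 ∧ trunc k U ⊆ W) ∈ 𝒲 ∧
      trunc k U ⊆ Classical.epsilon (fun W => W ∈ 𝒲 ∧ trunc k U ⊆ W) :=
  Classical.epsilon_spec hU.2.2

/-- The translation replacing, in round `k`, an ω-cover of `Z` by the family of sets whose
`k`-th truncated power refines it. -/
noncomputable def truncTranslation [T1Space X] [Infinite X] (h : IsFinitePower cube trunc) :
    SelectionTranslation (omegaCovers X) (omegaCovers X) (omegaCovers Z) (omegaCovers Z) where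
  one k 𝒲 := truncRefinement trunc k 𝒲
  two k 𝒲 U := Classical.epsilon fun W => W ∈ 𝒲 ∧ trunc k U ⊆ W
  one_mem k _ h𝒲 := h.truncRefinement_mem_omegaCovers k h𝒲
  two_mem _ _ _ _ hU := (exists_refinement_choice hU).1
  win 𝒲 P h𝒲 hP hwin := by
    refine isOmegaCover_iff.2 ⟨?_, ?_, fun G hG => ?_⟩
    · intro W hW
      obtain ⟨n, U, hU, rfl⟩ := Set.mem_iUnion.1 hW
      exact (h𝒲 n).1.1 _ (exists_refinement_choice ((hP n).1 hU)).1
    · intro hW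
      obtain ⟨n, U, hU, hu⟩ := Set.mem_iUnion.1 hW
      exact (h𝒲 n).1.2.2 (hu ▸ (exists_refinement_choice ((hP n).1 hU)).1)
    · obtain ⟨F, hF, m, hm⟩ := h.exhaust G hG
      have hmiss : ∀ U : Set X, ∃ x, U ≠ Set.univ → x ∉ U := fun U => by
        by_cases hU : U = Set.univ
        · exact ⟨Classical.arbitrary X, fun h => (h hU).elim⟩
        · obtain ⟨x, hx⟩ := (Set.ne_univ_iff_exists_notMem U).1 hU
          exact ⟨x, fun _ => hx⟩
      choose x hx using hmiss
      have hfin : (x '' ⋃ k ∈ Set.Iio m, P k).Finite :=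
        ((Set.finite_Iio m).biUnion fun k _ => (hP k).2).image x
      obtain ⟨U, hU, hFU⟩ := hwin.2 _ (hF.union hfin)
      obtain ⟨k, hk⟩ := Set.mem_iUnion.1 hU
      have hmk : m ≤ k := by
        by_contra hlt
        refine hx U ((hP k).1 hk).2.1 (hFU (Or.inr ⟨U, ?_, rfl⟩))
        exact Set.mem_biUnion (Set.mem_Iio.2 (not_le.1 hlt)) hk
      refine ⟨_, Set.mem_iUnion.2 ⟨k, U, hk, rfl⟩, ?_⟩
      exact (hm k hmk).trans ((h.trunc_mono k (Set.subset_union_left.trans hFU)).trans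
        (exists_refinement_choice ((hP k).1 hk)).2)

theorem oneConstFin_of_power [T1Space X] [Infinite X] (h : IsFinitePower cube trunc) :
    OneConstFin (omegaCovers Z) (omegaCovers Z) → OneConstFin (omegaCovers X) (omegaCovers X) := by
  refine not_imp_not.1 fun hX => (not_oneConstFin_iff nonempty_of_mem_omegaCovers).2 ?_
  intro 𝒲 h𝒲
  have hsub := fun k => (not_oneConstFin_iff nonempty_of_mem_omegaCovers).1 hX _
    (h.truncRefinement_mem_omegaCovers k h𝒲)
  choose 𝒰 h𝒰 hcount h𝒰Ω using hsub
  have hsub𝒲 : (⋃ k, (fun U => Classical.epsilon fun W => W ∈ 𝒲 ∧ trunc k U ⊆ W) '' 𝒰 k) ⊆ 𝒲 := by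
    refine Set.iUnion_subset fun k => ?_
    rintro _ ⟨U, hU, rfl⟩
    exact (exists_refinement_choice (h𝒰 k hU)).1
  refine ⟨_, hsub𝒲, Set.countable_iUnion fun k => (hcount k).image _, ?_⟩
  refine isOmegaCover_iff.2 ⟨fun W hW => h𝒲.1.1 W (hsub𝒲 hW), fun hu => h𝒲.1.2.2 (hsub𝒲 hu),
    fun G hG => ?_⟩
  obtain ⟨F, hF, m, hm⟩ := h.exhaust G hG
  obtain ⟨U, hU, hFU⟩ := (h𝒰Ω m).2 F hF
  exact ⟨_, Set.mem_iUnion.2 ⟨m, U, hU, rfl⟩, (hm m le_rfl).trans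
    ((h.trunc_mono m hFU).trans (exists_refinement_choice (h𝒰 m hU)).2)⟩

theorem oneConst1_of_power [T1Space X] [Infinite X] (h : IsFinitePower cube trunc) :
    OneConst1 (omegaCovers Z) (omegaCovers Z) → OneConst1 (omegaCovers X) (omegaCovers X) := by
  rw [oneConst1_iff_oneConstFin nonempty_of_mem_omegaCovers,
    oneConst1_iff_oneConstFin nonempty_of_mem_omegaCovers]
  exact h.oneConstFin_of_power

omit [TopologicalSpace Z] in
theorem leTwo1_cube {𝒞 : Set (Set (Set Z))} (h₁ : ∀ 𝒰 ∈ omegaCovers X, cube '' 𝒰 ∈ 𝒞)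
    (h₂ : ∀ 𝒰 : Set (Set X), (∀ U ∈ 𝒰, IsOpen U) → Set.univ ∉ 𝒰 → cube '' 𝒰 ∈ 𝒞 →
      𝒰 ∈ omegaCovers X) : LeTwo1 𝒞 𝒞 (omegaCovers X) (omegaCovers X) :=
  (cubeTranslation cube h₁ h₂).leTwo1
    ((cubeTranslation cube h₁ h₂).toSingle.oneConst fun _ => rfl)

omit [TopologicalSpace Z] in
theorem leTwoFin_cube {𝒞 : Set (Set (Set Z))} (h₁ : ∀ 𝒰 ∈ omegaCovers X, cube '' 𝒰 ∈ 𝒞)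
    (h₂ : ∀ 𝒰 : Set (Set X), (∀ U ∈ 𝒰, IsOpen U) → Set.univ ∉ 𝒰 → cube '' 𝒰 ∈ 𝒞 →
      𝒰 ∈ omegaCovers X) : LeTwoFin 𝒞 𝒞 (omegaCovers X) (omegaCovers X) :=
  (cubeTranslation cube h₁ h₂).leTwoFin
    ((cubeTranslation cube h₁ h₂).toFinite.oneConst fun _ => rfl)

theorem equiv1 [T1Space X] [Infinite X] (h : IsFinitePower cube trunc) :
    Equiv1 (omegaCovers X) (omegaCovers X) (omegaCovers Z) (omegaCovers Z) :=
  .of_le (h.truncTranslation.leTwo1 h.oneConst1_of_power)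
    (leTwo1_cube (fun _ => h.image_cube_mem_omegaCovers) fun _ => h.mem_omegaCovers_of_image_cube)

theorem equivFin [T1Space X] [Infinite X] (h : IsFinitePower cube trunc) :
    EquivFin (omegaCovers X) (omegaCovers X) (omegaCovers Z) (omegaCovers Z) :=
  .of_le (h.truncTranslation.leTwoFin h.oneConstFin_of_power)
    (leTwoFin_cube (fun _ => h.image_cube_mem_omegaCovers) fun _ => h.mem_omegaCovers_of_image_cube)

end IsFinitePower

end OmegaCovers

section Powers

variable {X : Type*} [TopologicalSpace X]

/-- A neighbourhood of a finite power of a finite set contains a power of a neighbourhood. -/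
theorem exists_isOpen_forall_mem {ι : Type*} [Finite ι] {F : Set X} (hF : F.Finite)
    {W : Set (ι → X)} (hW : IsOpen W) (hFW : ∀ p : ι → X, (∀ i, p i ∈ F) → p ∈ W) :
    ∃ U, IsOpen U ∧ F ⊆ U ∧ ∀ q : ι → X, (∀ i, q i ∈ U) → q ∈ W := by
  have hloc : ∀ p : ι → X, ∃ V : ι → Set X, (∀ i, p i ∈ F) →
      (∀ i, IsOpen (V i) ∧ p i ∈ V i) ∧ Set.univ.pi V ⊆ W := fun p => by
    by_cases hp : ∀ i, p i ∈ F
    · obtain ⟨V, hV, hVW⟩ := isOpen_pi_iff'.1 hW p (hFW p hp)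
      exact ⟨V, fun _ => ⟨hV, hVW⟩⟩
    · exact ⟨fun _ => ∅, fun h => (hp h).elim⟩
  choose V hV using hloc
  have hfin : {p : ι → X | ∀ i, p i ∈ F}.Finite := Set.Finite.pi' fun _ => hF
  refine ⟨⋃ x ∈ F, ⋂ p ∈ {p : ι → X | ∀ i, p i ∈ F}, ⋂ i : {i : ι // p i = x}, V p i, ?_, ?_, ?_⟩
  · exact isOpen_biUnion fun x _ => hfin.isOpen_biInter fun p hp =>
      isOpen_iInter_of_finite fun i => ((hV p hp).1 i).1
  · intro x hx
    refine Set.mem_biUnion hx (Set.mem_iInter₂.2 fun p hp => Set.mem_iInter.2 fun i => ?_)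
    have := ((hV p hp).1 i).2
    rwa [i.2] at this
  · intro q hq
    have hq' : ∀ i, ∃ x ∈ F, q i ∈ ⋂ p ∈ {p : ι → X | ∀ i, p i ∈ F},
      ⋂ i : {i : ι // p i = x}, V p i := fun i => by
        simpa only [Set.mem_iUnion₂, exists_prop] using hq i
    choose p hp hpq using hq'
    refine (hV p hp).2 fun i _ => ?_
    exact Set.mem_iInter.1 (Set.mem_iInter₂.1 (hpq i) p hp) ⟨i, rfl⟩

omit [TopologicalSpace X] in
theorem finite_forall_mem {ι : Type*} [Finite ι] {F : Set X} (hF : F.Finite) :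
    {p : ι → X | ∀ i, p i ∈ F}.Finite :=
  Set.Finite.pi' fun _ => hF

theorem isOpen_forall_mem {ι : Type*} [Finite ι] {U : Set X} (hU : IsOpen U) :
    IsOpen {p : ι → X | ∀ i, p i ∈ U} := by
  rw [Set.ofPred_forall]
  exact isOpen_iInter_of_finite fun i : ι => hU.preimage (continuous_apply i)

theorem isFinitePower_pi (ι : Type*) [Finite ι] [Nonempty ι] :
    IsFinitePower (fun A : Set X => {p : ι → X | ∀ i, p i ∈ A})
      (fun _ A => {p : ι → X | ∀ i, p i ∈ A}) where
  isOpen_cube _ := isOpen_forall_mem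
  cube_mono _ _ h _ hp i := h (hp i)
  trunc_mono _ _ _ h _ hp i := h (hp i)
  trunc_subset _ _ := subset_rfl
  trunc_finite _ _ := finite_forall_mem
  tube _ _ _ hF hW h := exists_isOpen_forall_mem hF hW fun _ hp => h hp
  exhaust G hG := ⟨⋃ p ∈ G, Set.range p, hG.biUnion fun p _ => Set.finite_range p, 0,
    fun _ _ p hp i => Set.mem_biUnion hp ⟨i, rfl⟩⟩
  diag := ⟨fun x _ => x, fun x A => by simp⟩

theorem isFinitePower_finPows :
    IsFinitePower (finPowsSet (X := X)) (fun k A => {p | p.1 < k ∧ p ∈ finPowsSet A}) where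
  isOpen_cube U hU := isOpen_sigma_iff.2 fun _ => isOpen_forall_mem hU
  cube_mono _ _ h _ hp i := h (hp i)
  trunc_mono _ _ _ h _ hp := ⟨hp.1, fun i => h (hp.2 i)⟩
  trunc_subset _ _ _ hp := hp.2
  trunc_finite k F hF := by
    refine ((Set.finite_Iio k).biUnion fun n _ =>
      (finite_forall_mem (ι := Fin (n + 1)) hF).image (Sigma.mk n)).subset ?_
    rintro ⟨n, p⟩ ⟨hn, hp⟩
    exact Set.mem_biUnion (Set.mem_Iio.2 hn) ⟨p, hp, rfl⟩
  tube k F W hF hW h := by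
    have hloc := fun n : Fin k => exists_isOpen_forall_mem hF (isOpen_sigma_iff.1 hW n)
      fun p hp => h (a := ⟨n, p⟩) ⟨n.2, hp⟩
    choose U hUo hFU hUW using hloc
    refine ⟨⋂ n, U n, isOpen_iInter_of_finite hUo, Set.subset_iInter hFU, ?_⟩
    rintro ⟨n, p⟩ ⟨hn, hp⟩
    exact hUW ⟨n, hn⟩ p fun i => Set.mem_iInter.1 (hp i) _
  exhaust G hG := by
    obtain ⟨m, hm⟩ := (hG.image Sigma.fst).bddAbove
    exact ⟨⋃ p ∈ G, Set.range p.2, hG.biUnion fun p _ => Set.finite_range p.2, m + 1,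
      fun k hk p hp => ⟨(Nat.lt_succ_of_le (hm ⟨p, hp, rfl⟩)).trans_le hk,
        fun i => Set.mem_biUnion hp ⟨i, rfl⟩⟩⟩
  diag := ⟨fun x => ⟨0, fun _ => x⟩, fun x A => by simp [finPowsSet]⟩

theorem image_finPowsSet_mem_openCovers {𝒰 : Set (Set X)} (h𝒰 : 𝒰 ∈ omegaCovers X) :
    finPowsSet '' 𝒰 ∈ openCovers (FinPows X) :=
  (isFinitePower_finPows.image_cube_mem_omegaCovers h𝒰).1

/-- A finite set is a point of `X^{<ω}`, so a cover of `X^{<ω}` by powers comes from an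
ω-cover. -/
theorem mem_omegaCovers_of_image_finPowsSet [Nonempty X] (𝒰 : Set (Set X))
    (ho : ∀ U ∈ 𝒰, IsOpen U) (hu : Set.univ ∉ 𝒰)
    (hc : finPowsSet '' 𝒰 ∈ openCovers (FinPows X)) : 𝒰 ∈ omegaCovers X := by
  refine isOmegaCover_iff.2 ⟨ho, hu, fun F hF => ?_⟩
  obtain ⟨n, p, hp⟩ : ∃ (n : ℕ) (p : Fin (n + 1) → X), F ⊆ Set.range p := by
    obtain ⟨n, f, hf⟩ := hF.fin_embedding
    refine ⟨n, Fin.snoc f (Classical.arbitrary X), ?_⟩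
    rw [← hf]
    rintro _ ⟨i, rfl⟩
    exact ⟨i.castSucc, by simp⟩
  obtain ⟨_, ⟨U, hU, rfl⟩, hpU⟩ := IsNontrivialOpenCover.exists_mem hc ⟨n, p⟩
  refine ⟨U, hU, hp.trans ?_⟩
  rintro _ ⟨i, rfl⟩
  exact hpU i

end Powers

section OpenCovers

variable {Y : Type*} [TopologicalSpace Y]

theorem range_mem_openCovers {𝒱 : ℕ → Set (Set Y)} {V : ℕ → Set Y}
    (h𝒱 : ∀ n, 𝒱 n ∈ openCovers Y) (hV : ∀ n, V n ∈ 𝒱 n) (hc : ∀ y, ∃ n, y ∈ V n) :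
    Set.range V ∈ openCovers Y := by
  refine ⟨?_, Set.eq_univ_of_forall fun y => ?_, ?_⟩
  · rintro _ ⟨n, rfl⟩
    exact (h𝒱 n).1 _ (hV n)
  · obtain ⟨n, hn⟩ := hc y
    exact ⟨V n, ⟨n, rfl⟩, hn⟩
  · rintro ⟨n, hn⟩
    exact (h𝒱 n).2.2 (hn ▸ hV n)

theorem exists_mem_of_range_mem_omegaCovers {ι : Type*} {U : ι → Set Y}
    (h : Set.range U ∈ omegaCovers Y) (y : Y) : ∃ n, y ∈ U n := by
  obtain ⟨_, ⟨n, rfl⟩, hn⟩ := IsNontrivialOpenCover.exists_mem h.1 y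
  exact ⟨n, hn⟩

/-- In the finite-selection game an open cover may be replaced by its finite unions, unless it
has a finite subcover, in which case Two wins at once. -/
theorem exists_translation_finite [T1Space Y] [Infinite Y] :
    ∃ T : Translation (finite (omegaCovers Y) (omegaCovers Y))
      (finite (openCovers Y) (openCovers Y)), ∀ n, T.one n = T.one 0 := by
  classical
  obtain ⟨𝒰₀, h𝒰₀⟩ := omegaCovers_nonempty (X := Y)
  have hsub : ∀ 𝒱 : Set (Set Y), ∃ S : Set (Set Y), S ⊆ 𝒱 ∧ S.Finite ∧
      ((∃ S' ⊆ 𝒱, S'.Finite ∧ ⋃₀ S' = Set.univ) → ⋃₀ S = Set.univ) := fun 𝒱 => by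
    by_cases h : ∃ S' ⊆ 𝒱, S'.Finite ∧ ⋃₀ S' = Set.univ
    · obtain ⟨S, h₁, h₂, h₃⟩ := h
      exact ⟨S, h₁, h₂, fun _ => h₃⟩
    · exact ⟨∅, Set.empty_subset _, Set.finite_empty, fun h' => (h h').elim⟩
  have hdec : ∀ (𝒱 : Set (Set Y)) (U : Set Y), ∃ S : Set (Set Y), S ⊆ 𝒱 ∧ S.Finite ∧
      ((∃ S' ⊆ 𝒱, S'.Finite ∧ ⋃₀ S' = U) → ⋃₀ S = U) := fun 𝒱 U => by
    by_cases h : ∃ S' ⊆ 𝒱, S'.Finite ∧ ⋃₀ S' = U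
    · obtain ⟨S, h₁, h₂, h₃⟩ := h
      exact ⟨S, h₁, h₂, fun _ => h₃⟩
    · exact ⟨∅, Set.empty_subset _, Set.finite_empty, fun h' => (h h').elim⟩
  choose S hS𝒱 hSfin hS using hsub
  choose D hD𝒱 hDfin hD using hdec
  have hlegal : ∀ (𝒱 : Set (Set Y)) (F : Set (Set Y)), F.Finite →
      (S 𝒱 ∪ ⋃ U ∈ F, D 𝒱 U) ⊆ 𝒱 ∧ (S 𝒱 ∪ ⋃ U ∈ F, D 𝒱 U).Finite := fun 𝒱 F hF =>
    ⟨Set.union_subset (hS𝒱 𝒱) (Set.iUnion₂_subset fun U _ => hD𝒱 𝒱 U),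
      (hSfin 𝒱).union (hF.biUnion fun U _ => hDfin 𝒱 U)⟩
  refine ⟨{
    one := fun _ 𝒱 => if ∃ S' ⊆ 𝒱, S'.Finite ∧ ⋃₀ S' = Set.univ then 𝒰₀
      else {U | ∃ S' ⊆ 𝒱, S'.Finite ∧ ⋃₀ S' = U}
    two := fun _ 𝒱 F => S 𝒱 ∪ ⋃ U ∈ F, D 𝒱 U
    one_mem := fun _ 𝒱 h𝒱 => ?_
    two_legal := fun _ 𝒱 _ F hF => hlegal 𝒱 F hF.2
    win := fun 𝒱 F h𝒱 hF hwin => ?_ }, fun _ => rfl⟩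
  · split_ifs with hfin
    · exact h𝒰₀
    refine isOmegaCover_iff.2 ⟨?_, hfin, fun G hG => ?_⟩
    · rintro _ ⟨S', hS', -, rfl⟩
      exact isOpen_sUnion fun V hV => h𝒱.1 V (hS' hV)
    · choose V hV hyV using fun y => IsNontrivialOpenCover.exists_mem h𝒱 y
      exact ⟨⋃₀ (V '' G), ⟨V '' G, Set.image_subset_iff.2 fun y _ => hV y, hG.image V, rfl⟩,
        fun y hy => ⟨V y, ⟨y, hy, rfl⟩, hyV y⟩⟩
  · have hsub := fun n => (hlegal (𝒱 n) (F n) (hF n).2).1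
    refine ⟨fun V hV => ?_, Set.eq_univ_of_forall fun y => ?_, fun hu => ?_⟩
    · obtain ⟨n, hn⟩ := Set.mem_iUnion.1 hV
      exact (h𝒱 n).1 V (hsub n hn)
    · obtain ⟨U, hU, hyU⟩ := IsNontrivialOpenCover.exists_mem hwin.1 y
      obtain ⟨n, hn⟩ := Set.mem_iUnion.1 hU
      have hUn := (hF n).1 hn
      split_ifs at hUn with hfin
      · obtain ⟨V, hV, hyV⟩ := (hS _ hfin).ge (Set.mem_univ y)
        exact ⟨V, Set.mem_iUnion.2 ⟨n, Or.inl hV⟩, hyV⟩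
      · obtain ⟨V, hV, hyV⟩ := (hD _ _ hUn).ge hyU
        exact ⟨V, Set.mem_iUnion.2 ⟨n, Or.inr (Set.mem_biUnion hn hV)⟩, hyV⟩
    · obtain ⟨n, hn⟩ := Set.mem_iUnion.1 hu
      exact (h𝒱 n).2.2 (hsub n hn)

theorem leTwoFin_omegaCovers_openCovers [T1Space Y] [Infinite Y] :
    LeTwoFin (omegaCovers Y) (omegaCovers Y) (openCovers Y) (openCovers Y) := by
  obtain ⟨T, hT⟩ := exists_translation_finite (Y := Y)
  exact ⟨T.twoMarkov, T.twoWin, mt T.oneWin, mt T.onePre, mt (T.oneConst hT)⟩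

/-- Every single move of a strategy of Two against ω-covers is forced on the supersets of some
finite set. -/
theorem exists_finite_forcing (g : Set (Set Y) → Set Y) (hg : ∀ 𝒰 ∈ omegaCovers Y, g 𝒰 ∈ 𝒰) :
    ∃ F : Set Y, F.Finite ∧ ∀ U, IsOpen U → U ≠ Set.univ → F ⊆ U →
      ∃ 𝒰 ∈ omegaCovers Y, g 𝒰 = U := by
  by_contra! hno
  choose! U hUo hUu hFU hU using hno
  have hΩ : U '' {F | F.Finite} ∈ omegaCovers Y := by
    refine isOmegaCover_iff.2 ⟨?_, ?_, fun F hF => ⟨U F, ⟨F, hF, rfl⟩, hFU F hF⟩⟩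
    · rintro _ ⟨F, hF, rfl⟩
      exact hUo F hF
    · rintro ⟨F, hF, h⟩
      exact hUu F hF h
  obtain ⟨F, hF, h⟩ := hg _ hΩ
  exact hU F hF _ hΩ h.symm

theorem countable_of_twoMarkov1 [T1Space Y] [Infinite Y]
    (h : TwoMarkov1 (omegaCovers Y) (omegaCovers Y)) : Countable Y := by
  obtain ⟨τ, hτ⟩ := h
  choose F hF hforce using fun n => exists_finite_forcing (fun 𝒰 => τ 𝒰 n)
    fun 𝒰 h𝒰 => (hτ (fun _ => 𝒰) fun _ => h𝒰).1 n
  refine Set.countable_univ_iff.1 ((Set.countable_iUnion fun n => (hF n).countable).mono ?_)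
  intro y _
  by_contra hy
  choose 𝒰 h𝒰 hτ𝒰 using fun n => hforce n {y}ᶜ isOpen_compl_singleton
    (fun h => (h.ge (Set.mem_univ y)) rfl)
    (Set.subset_compl_singleton_iff.2 fun h => hy (Set.mem_iUnion.2 ⟨n, h⟩))
  obtain ⟨n, hn⟩ := exists_mem_of_range_mem_omegaCovers (hτ 𝒰 h𝒰).2 y
  rw [hτ𝒰] at hn
  exact hn rfl

theorem twoMarkov1_openCovers [Countable Y] [Nonempty Y] :
    TwoMarkov1 (openCovers Y) (openCovers Y) := by
  obtain ⟨e, he⟩ := exists_surjective_nat Y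
  refine ⟨fun 𝒱 n => Classical.epsilon fun V => V ∈ 𝒱 ∧ e n ∈ V, fun 𝒱 h𝒱 => ?_⟩
  have hV := fun n => Classical.epsilon_spec
    (p := fun V => V ∈ 𝒱 n ∧ e n ∈ V) (IsNontrivialOpenCover.exists_mem (h𝒱 n) (e n))
  refine ⟨fun n => (hV n).1, range_mem_openCovers h𝒱 (fun n => (hV n).1) fun y => ?_⟩
  obtain ⟨n, rfl⟩ := he y
  exact ⟨n, (hV n).2⟩

theorem exists_seq_of_list {α : Type*} {P : List α → Prop} {R : List α → α → Prop} (h₀ : P [])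
    (hs : ∀ l, P l → ∃ u, P (l ++ [u]) ∧ R l u) :
    ∃ u : ℕ → α, ∀ n, R (List.ofFn fun i : Fin n => u i) (u n) := by
  choose f hP hR using hs
  let l : ℕ → {l // P l} := fun n => Nat.rec ⟨[], h₀⟩ (fun _ l => ⟨l.1 ++ [f l.1 l.2], hP _ _⟩) n
  refine ⟨fun n => f (l n).1 (l n).2, fun n => ?_⟩
  rw [← eq_ofFn_of_append (l := fun n => (l n).1) (f := fun n => f (l n).1 (l n).2) rfl
    fun _ => rfl]
  exact hR _ _

theorem twoWin1_mem {ι : Type*} {A : Set (Set ι)} {τ : List (Set ι) → ι}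
    (hτ : ∀ a : ℕ → Set ι, (∀ n, a n ∈ A) →
      ∀ n, τ (List.ofFn fun i : Fin (n + 1) => a i) ∈ a n)
    {l : List (Set ι)} (hl : ∀ a ∈ l, a ∈ A) {b : Set ι} (hb : b ∈ A) : τ (l ++ [b]) ∈ b := by
  have h := hτ (fun n => (l ++ [b])[n]?.getD b) (fun n => ?_) l.length
  · have hofFn : (List.ofFn fun i : Fin (l.length + 1) => (l ++ [b])[(i : ℕ)]?.getD b) =
        l ++ [b] := by
      refine List.ext_getElem (by simp) fun i h₁ h₂ => ?_
      rw [List.getElem_ofFn, List.getElem?_eq_getElem h₂, Option.getD_some]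
    rw [hofFn] at h
    simpa using h
  · rcases h : (l ++ [b])[n]? with _ | a
    · exact hb
    · rcases List.mem_append.1 (List.mem_of_getElem? h) with ha | ha
      · exact hl a ha
      · exact List.mem_singleton.1 ha ▸ hb

theorem twoWin1_openCovers [Nonempty Y] (h : TwoWin1 (omegaCovers Y) (omegaCovers Y)) :
    TwoWin1 (openCovers Y) (openCovers Y) := by
  obtain ⟨τ, hτ⟩ := h
  have hpts : ∀ l : List (Set (Set Y)), ∃ p : Y × List Y, (∀ 𝒰 ∈ l, 𝒰 ∈ omegaCovers Y) →
      ∀ U, IsOpen U → U ≠ Set.univ → (∀ y ∈ p.1 :: p.2, y ∈ U) →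
        ∃ 𝒰 ∈ omegaCovers Y, τ (l ++ [𝒰]) = U := fun l => by
    by_cases hl : ∀ 𝒰 ∈ l, 𝒰 ∈ omegaCovers Y
    · obtain ⟨F, hF, hforce⟩ := exists_finite_forcing (fun 𝒰 => τ (l ++ [𝒰]))
        fun 𝒰 h𝒰 => twoWin1_mem (fun a ha => (hτ a ha).1) hl h𝒰
      refine ⟨(Classical.arbitrary Y, hF.toFinset.toList), fun _ U hUo hUu hU =>
        hforce U hUo hUu fun y hy => hU y ?_⟩
      simp [hy]
    · exact ⟨(Classical.arbitrary Y, []), fun h => (hl h).elim⟩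
  choose pts hforce using hpts
  let pick : Set (Set Y) → Y → Set Y := fun 𝒱 y => Classical.epsilon fun V => V ∈ 𝒱 ∧ y ∈ V
  have hpick : ∀ 𝒱 ∈ openCovers Y, ∀ y, pick 𝒱 y ∈ 𝒱 ∧ y ∈ pick 𝒱 y := fun 𝒱 h𝒱 y =>
    Classical.epsilon_spec (p := fun V => V ∈ 𝒱 ∧ y ∈ V) (IsNontrivialOpenCover.exists_mem h𝒱 y)
  let extend : List (Set (Set Y)) → Set Y → List (Set (Set Y)) := fun l U =>
    l ++ [Classical.epsilon fun 𝒰 => 𝒰 ∈ omegaCovers Y ∧ τ (l ++ [𝒰]) = U]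
  -- A state consists of a position against `τ`, the points still to be covered before the next
  -- move there, and the union of the sets picked since the last one.
  refine twoWin_of_automaton (G := single (openCovers Y) (openCovers Y))
    (S := List (Set (Set Y)) × (Y × List Y) × Set Y) ([], pts [], ∅)
    (fun s 𝒱 => pick 𝒱 s.2.1.1)
    (fun s 𝒱 => match s.2.1.2 with
      | [] => (extend s.1 (s.2.2 ∪ pick 𝒱 s.2.1.1),
          pts (extend s.1 (s.2.2 ∪ pick 𝒱 s.2.1.1)), ∅)
      | z :: r => (s.1, (z, r), s.2.2 ∪ pick 𝒱 s.2.1.1))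
    fun 𝒱 s h𝒱 hs₀ hs => ?_
  have hV := fun n => hpick (𝒱 n) (h𝒱 n) (s n).2.1.1
  refine ⟨fun n => (hV n).1, range_mem_openCovers h𝒱 (fun n => (hV n).1) ?_⟩
  set C := ⋃ n, pick (𝒱 n) (s n).2.1.1
  suffices C = Set.univ from fun y => Set.mem_iUnion.1 (this.ge (Set.mem_univ y))
  by_contra hCu
  have hround : ∀ (l : List (Set (Set Y))), (∀ 𝒰 ∈ l, 𝒰 ∈ omegaCovers Y) →
      ∀ (r : List Y) (n : ℕ) (y : Y) (U : Set Y), s n = (l, (y, r), U) → IsOpen U → U ⊆ C →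
        (∀ z ∈ (pts l).1 :: (pts l).2, z ∈ U ∨ z ∈ y :: r) →
        ∃ 𝒰 ∈ omegaCovers Y, τ (l ++ [𝒰]) ⊆ C ∧
          ∃ m, s m = (l ++ [𝒰], pts (l ++ [𝒰]), ∅) := by
    intro l hl r
    induction r with
    | nil =>
      intro n y U hn hUo hUC hcov
      have hVn := hV n
      have hsn := hs n
      have hVC : pick (𝒱 n) (s n).2.1.1 ⊆ C := Set.subset_iUnion_of_subset n subset_rfl
      rw [hn] at hVn hsn hVC
      dsimp only at hVn hsn hVC
      have hUVC := Set.union_subset hUC hVC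
      have hspec := Classical.epsilon_spec (hforce l hl (U ∪ pick (𝒱 n) y)
        (hUo.union ((h𝒱 n).1 _ hVn.1)) (fun h => hCu (Set.univ_subset_iff.1 (h ▸ hUVC)))
        fun z hz => (hcov z hz).imp id fun h => by rw [List.mem_singleton.1 h]; exact hVn.2)
      exact ⟨_, hspec.1, hspec.2.symm ▸ hUVC, n + 1, hsn⟩
    | cons z r ih =>
      intro n y U hn hUo hUC hcov
      have hVn := hV n
      have hsn := hs n
      have hVC : pick (𝒱 n) (s n).2.1.1 ⊆ C := Set.subset_iUnion_of_subset n subset_rfl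
      rw [hn] at hVn hsn hVC
      dsimp only at hVn hsn hVC
      refine ih (n + 1) z _ hsn (hUo.union ((h𝒱 n).1 _ hVn.1)) (Set.union_subset hUC hVC)
        fun w hw => ?_
      rcases hcov w hw with h | h
      · exact Or.inl (Or.inl h)
      · rcases List.mem_cons.1 h with rfl | h
        · exact Or.inl (Or.inr hVn.2)
        · exact Or.inr h
  obtain ⟨𝒰, h𝒰⟩ := exists_seq_of_list
    (P := fun l => (∀ 𝒰 ∈ l, 𝒰 ∈ omegaCovers Y) ∧ ∃ n, s n = (l, pts l, ∅))
    (R := fun l 𝒰 => 𝒰 ∈ omegaCovers Y ∧ τ (l ++ [𝒰]) ⊆ C) ⟨by simp, 0, hs₀⟩ (by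
      rintro l ⟨hl, n, hn⟩
      obtain ⟨𝒰, h𝒰, hC, hm⟩ := hround l hl _ n _ _ hn isOpen_empty (Set.empty_subset _)
        fun z hz => Or.inr hz
      refine ⟨𝒰, ⟨fun 𝒲 h𝒲 => ?_, hm⟩, h𝒰, hC⟩
      rcases List.mem_append.1 h𝒲 with h | h
      · exact hl _ h
      · exact List.mem_singleton.1 h ▸ h𝒰)
  refine hCu (Set.eq_univ_of_forall fun y => ?_)
  obtain ⟨n, hn⟩ := exists_mem_of_range_mem_omegaCovers (hτ 𝒰 fun n => (h𝒰 n).1).2 y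
  refine (h𝒰 n).2 ?_
  rw [List.ofFn_succ', List.concat_eq_append] at hn
  exact hn

/-- The finite sequence `l` consists of legal answers to the strategy `σ` of One in the
single-selection game. -/
def IsPlay {ι : Type*} (σ : List ι → Set ι) (l : List ι) : Prop :=
  ∀ i x, l[i]? = some x → x ∈ σ (l.take i)

theorem IsPlay.append {ι : Type*} {σ : List ι → Set ι} {l : List ι} (hl : IsPlay σ l) {x : ι}
    (hx : x ∈ σ l) : IsPlay σ (l ++ [x]) := by
  intro i y hy
  rcases lt_trichotomy i l.length with hi | rfl | hi
  · rw [List.getElem?_append_left hi] at hy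
    rw [List.take_append_of_le_length hi.le]
    exact hl i y hy
  · simp only [List.getElem?_concat_length, Option.some.injEq] at hy
    simpa [hy] using hx
  · rw [List.getElem?_eq_none (by simpa using hi)] at hy
    cases hy

theorem IsPlay.exists_mem {ι : Type*} {σ : List ι → Set ι} {l : List ι} (hl : IsPlay σ l) {x : ι}
    (hx : x ∈ l) : ∃ k, x ∈ σ k := by
  obtain ⟨i, hi⟩ := List.mem_iff_getElem?.1 hx
  exact ⟨_, hl i x hi⟩

/-- An unbounded increasing chain of finite plays has a limit. -/
theorem exists_limit_play {ι : Type*} {σ : List ι → Set ι} (l : ℕ → List ι)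
    (hplay : ∀ n, IsPlay σ (l n)) (hpre : ∀ n, l n <+: l (n + 1)) (hlen : ∀ n, n ≤ (l n).length) :
    ∃ x : ℕ → ι, (∀ n, x n ∈ σ (List.ofFn fun i : Fin n => x i)) ∧
      ∀ n, ∀ y ∈ l n, y ∈ Set.range x := by
  have hmono : ∀ m n, m ≤ n → l m <+: l n := fun m n hmn => by
    induction n, hmn using Nat.le_induction with
    | base => exact List.prefix_rfl
    | succ n _ ih => exact ih.trans (hpre n)
  have hlt : ∀ n, n < (l (n + 1)).length := fun n => hlen (n + 1)
  have key : ∀ m i (hi : i < (l m).length), (l m)[i] = (l (i + 1))[i]'(hlt i) := fun m i hi => by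
    rcases le_total m (i + 1) with h | h
    · exact (hmono _ _ h).getElem hi
    · exact ((hmono _ _ h).getElem (hlt i)).symm
  refine ⟨fun n => (l (n + 1))[n]'(hlt n), fun n => ?_, fun n y hy => ?_⟩
  · have hofFn : (List.ofFn fun i : Fin n => (l (i + 1))[(i : ℕ)]'(hlt i)) =
        (l (n + 1)).take n := by
      refine List.ext_getElem (by simp [(hlt n).le]) fun i h₁ h₂ => ?_
      rw [List.getElem_ofFn, List.getElem_take]
      exact (key _ _ _).symm
    rw [hofFn]
    exact hplay (n + 1) n _ (List.getElem?_eq_getElem (hlt n))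
  · obtain ⟨i, hi, rfl⟩ := List.mem_iff_getElem.1 hy
    exact ⟨i, (key n i hi).symm⟩

/-- A finite play against a strategy of One with nonempty moves extends to an infinite one. -/
theorem IsPlay.exists_extension {ι : Type*} {σ : List ι → Set ι} (hσ : ∀ l, (σ l).Nonempty)
    {l : List ι} (hl : IsPlay σ l) :
    ∃ x : ℕ → ι, (∀ n, x n ∈ σ (List.ofFn fun i : Fin n => x i)) ∧ ∀ y ∈ l, y ∈ Set.range x := by
  choose f hf using hσ
  let k : ℕ → List ι := fun n => Nat.rec l (fun _ l => l ++ [f l]) n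
  have hk : ∀ n, k (n + 1) = k n ++ [f (k n)] := fun _ => rfl
  obtain ⟨x, hx, hmem⟩ := exists_limit_play k
    (fun n => by
      induction n with
      | zero => exact hl
      | succ n ih => exact hk n ▸ ih.append (hf _))
    (fun n => hk n ▸ List.prefix_append _ _)
    (fun n => by
      induction n with
      | zero => exact Nat.zero_le _
      | succ n ih => simpa [hk] using ih)
  exact ⟨x, hx, hmem 0⟩

theorem oneWin1_omegaCovers [Nonempty Y] (h : OneWin1 (openCovers Y) (openCovers Y)) :
    OneWin1 (omegaCovers Y) (omegaCovers Y) := by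
  classical
  obtain ⟨σ, hσ, hwin⟩ := h
  have hnotcover : ∀ x : ℕ → Set Y, (∀ n, x n ∈ σ (List.ofFn fun i : Fin n => x i)) →
      ∃ y, ∀ n, y ∉ x n := fun x hx => by
    by_contra! hc
    exact hwin x hx (range_mem_openCovers (fun n => hσ _) hx hc)
  let cover : {l // IsPlay σ l} → Set (Set Y) := fun l =>
    {U | ∃ t, t ≠ [] ∧ IsPlay σ (l.1 ++ t) ∧ ⋃₀ {V | V ∈ t} = U}
  have hcover : ∀ l, cover l ∈ omegaCovers Y := fun l => by
    refine isOmegaCover_iff.2 ⟨?_, ?_, fun F hF => ?_⟩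
    · rintro _ ⟨t, -, ht, rfl⟩
      refine isOpen_sUnion fun V hV => ?_
      obtain ⟨k, hk⟩ := ht.exists_mem (List.mem_append_right _ hV)
      exact (hσ k).1 V hk
    · rintro ⟨t, -, ht, hu⟩
      obtain ⟨x, hx, hmem⟩ := ht.exists_extension fun k => nonempty_of_mem_openCovers _ (hσ k)
      obtain ⟨y, hy⟩ := hnotcover x hx
      obtain ⟨V, hV, hyV⟩ := hu.ge (Set.mem_univ y)
      obtain ⟨n, rfl⟩ := hmem V (List.mem_append_right _ hV)
      exact hy n hyV
    · suffices ∃ t, t ≠ [] ∧ IsPlay σ (l.1 ++ t) ∧ F ⊆ ⋃₀ {V | V ∈ t} by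
        obtain ⟨t, h₀, ht, hFt⟩ := this
        exact ⟨_, ⟨t, h₀, ht, rfl⟩, hFt⟩
      induction F, hF using Set.Finite.induction_on with
      | empty =>
        obtain ⟨V, hV⟩ := nonempty_of_mem_openCovers _ (hσ l.1)
        exact ⟨[V], by simp, l.2.append hV, Set.empty_subset _⟩
      | @insert y F _ _ ih =>
        obtain ⟨t, -, ht, hFt⟩ := ih
        obtain ⟨V, hV, hyV⟩ := IsNontrivialOpenCover.exists_mem (hσ (l.1 ++ t)) y
        refine ⟨t ++ [V], by simp, List.append_assoc _ _ _ ▸ ht.append hV, ?_⟩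
        refine Set.insert_subset ⟨V, by simp, hyV⟩ (hFt.trans (Set.sUnion_mono fun W hW => ?_))
        exact List.mem_append_left _ hW
  refine oneWin_of_automaton (G := single (omegaCovers Y) (omegaCovers Y))
    (S := {l // IsPlay σ l}) ⟨[], fun i x h => by simp at h⟩ cover
    (fun l U => if hU : U ∈ cover l then ⟨l.1 ++ hU.choose, hU.choose_spec.2.1⟩ else l) hcover ?_
  intro U l _ hl hU hΩ
  have hstep : ∀ n, ∃ t, t ≠ [] ∧ (l (n + 1)).1 = (l n).1 ++ t ∧ ⋃₀ {V | V ∈ t} = U n := fun n => by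
    have hUn : U n ∈ cover (l n) := hU n
    refine ⟨hUn.choose, hUn.choose_spec.1, ?_, hUn.choose_spec.2.2⟩
    rw [hl, dif_pos hUn]
  choose t ht₀ hlt htU using hstep
  obtain ⟨x, hx, hmem⟩ := exists_limit_play (fun n => (l n).1) (fun n => (l n).2)
    (fun n => hlt n ▸ List.prefix_append _ _)
    (fun n => by
      induction n with
      | zero => exact Nat.zero_le _
      | succ n ih =>
        have := List.length_pos_iff.2 (ht₀ n)
        simp only [hlt, List.length_append]
        omega)
  obtain ⟨y, hy⟩ := hnotcover x hx
  obtain ⟨n, hn⟩ := exists_mem_of_range_mem_omegaCovers hΩ y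
  rw [← htU] at hn
  obtain ⟨V, hV, hyV⟩ := hn
  obtain ⟨m, rfl⟩ := hmem (n + 1) V (by rw [hlt]; exact List.mem_append_right _ hV)
  exact hy m hyV

theorem onePre1_omegaCovers [Nonempty Y] (h : OnePre1 (openCovers Y) (openCovers Y)) :
    OnePre1 (omegaCovers Y) (omegaCovers Y) := by
  obtain ⟨σ, hσ, hwin⟩ := h
  have hnotcover : ∀ x : ℕ → Set Y, (∀ n, x n ∈ σ n) → ∃ y, ∀ n, y ∉ x n := fun x hx => by
    by_contra! hc
    exact hwin x hx (range_mem_openCovers hσ hx hc)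
  refine ⟨fun k => {U | ∃ (m : ℕ) (V : ℕ → Set Y),
    (∀ j, V j ∈ σ (Nat.pair k j)) ∧ ⋃ j ∈ Set.Iio m, V j = U}, fun k => ?_, fun U hU hΩ => ?_⟩
  · refine isOmegaCover_iff.2 ⟨?_, ?_, fun F hF => ?_⟩
    · rintro _ ⟨m, V, hV, rfl⟩
      exact isOpen_biUnion fun j _ => (hσ _).1 _ (hV j)
    · rintro ⟨m, V, hV, hu⟩
      choose d hd using fun n => nonempty_of_mem_openCovers _ (hσ n)
      obtain ⟨y, hy⟩ := hnotcover
        (fun i => if i.unpair.1 = k then V i.unpair.2 else d i) fun i => by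
          split_ifs with hi
          · have := hV i.unpair.2
            rwa [← hi, Nat.pair_unpair] at this
          · exact hd i
      obtain ⟨j, -, hj⟩ := Set.mem_iUnion₂.1 (hu.ge (Set.mem_univ y))
      exact hy (Nat.pair k j) (by simpa using hj)
    · obtain ⟨m, f, hf⟩ := hF.fin_embedding
      choose V hV hVmem using fun j => IsNontrivialOpenCover.exists_mem (hσ (Nat.pair k j))
        (if hj : j < m then f ⟨j, hj⟩ else Classical.arbitrary Y)
      refine ⟨_, ⟨m, V, hV, rfl⟩, ?_⟩
      rw [← hf]
      rintro _ ⟨i, rfl⟩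
      have := hVmem i
      rw [dif_pos i.2] at this
      exact Set.mem_biUnion (Set.mem_Iio.2 i.2) this
  · choose m V hV hVU using hU
    obtain ⟨y, hy⟩ := hnotcover (fun i => V i.unpair.1 i.unpair.2) fun i => by
      have := hV i.unpair.1 i.unpair.2
      rwa [Nat.pair_unpair] at this
    obtain ⟨k, hk⟩ := exists_mem_of_range_mem_omegaCovers hΩ y
    rw [← hVU] at hk
    obtain ⟨j, -, hj⟩ := Set.mem_iUnion₂.1 hk
    exact hy (Nat.pair k j) (by simpa using hj)

theorem leTwo1_omegaCovers_openCovers [T1Space Y] [Infinite Y] :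
    LeTwo1 (omegaCovers Y) (omegaCovers Y) (openCovers Y) (openCovers Y) := by
  refine ⟨fun h => ?_, twoWin1_openCovers, mt oneWin1_omegaCovers, mt onePre1_omegaCovers, ?_⟩
  · have := countable_of_twoMarkov1 h
    exact twoMarkov1_openCovers
  · rw [oneConst1_iff_oneConstFin nonempty_of_mem_omegaCovers,
      oneConst1_iff_oneConstFin nonempty_of_mem_openCovers]
    exact leTwoFin_omegaCovers_openCovers.2.2.2.2

end OpenCovers

theorem Equiv1.symm_trans {ι κ μ : Type*} {A C : Set (Set ι)} {B D : Set (Set κ)}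
    {E F : Set (Set μ)} (h : Equiv1 A C B D) (h' : Equiv1 A C E F) : Equiv1 B D E F :=
  ⟨h.1.symm.trans h'.1, h.2.1.symm.trans h'.2.1, h.2.2.1.symm.trans h'.2.2.1,
    h.2.2.2.1.symm.trans h'.2.2.2.1, h.2.2.2.2.symm.trans h'.2.2.2.2⟩

theorem EquivFin.symm_trans {ι κ μ : Type*} {A C : Set (Set ι)} {B D : Set (Set κ)}
    {E F : Set (Set μ)} (h : EquivFin A C B D) (h' : EquivFin A C E F) : EquivFin B D E F :=
  ⟨h.1.symm.trans h'.1, h.2.1.symm.trans h'.2.1, h.2.2.1.symm.trans h'.2.2.1,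
    h.2.2.2.1.symm.trans h'.2.2.2.1, h.2.2.2.2.symm.trans h'.2.2.2.2⟩

/-- For an infinite Hausdorff space `X`, `n ≥ 1`, and both selection games:
`G_□(Ω_X,Ω_X) ≡ G_□(Ω_{Xⁿ},Ω_{Xⁿ}) ≡ G_□(Ω_{X^{<ω}},Ω_{X^{<ω}})
  ≡ G_□(O_{X^{<ω}},O_{X^{<ω}})`. -/
theorem statement3 {X : Type*} [TopologicalSpace X] [T2Space X] [Infinite X]
    (n : ℕ) (hn : 1 ≤ n) :
    (Equiv1 (omegaCovers X) (omegaCovers X)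
        (omegaCovers (Fin n → X)) (omegaCovers (Fin n → X)) ∧
     Equiv1 (omegaCovers (Fin n → X)) (omegaCovers (Fin n → X))
        (omegaCovers (FinPows X)) (omegaCovers (FinPows X)) ∧
     Equiv1 (omegaCovers (FinPows X)) (omegaCovers (FinPows X))
        (openCovers (FinPows X)) (openCovers (FinPows X))) ∧
    (EquivFin (omegaCovers X) (omegaCovers X)
        (omegaCovers (Fin n → X)) (omegaCovers (Fin n → X)) ∧
     EquivFin (omegaCovers (Fin n → X)) (omegaCovers (Fin n → X))
        (omegaCovers (FinPows X)) (omegaCovers (FinPows X)) ∧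
     EquivFin (omegaCovers (FinPows X)) (omegaCovers (FinPows X))
        (openCovers (FinPows X)) (openCovers (FinPows X))) := by

  have : Nonempty (Fin n) := ⟨⟨0, hn⟩⟩
  have hpi := isFinitePower_pi (X := X) (Fin n)
  have hpow := isFinitePower_finPows (X := X)
  have hcube₁ : LeTwo1 (openCovers (FinPows X)) (openCovers (FinPows X))
      (omegaCovers X) (omegaCovers X) :=
    IsFinitePower.leTwo1_cube (fun _ => image_finPowsSet_mem_openCovers)
      mem_omegaCovers_of_image_finPowsSet
  have hcubeFin : LeTwoFin (openCovers (FinPows X)) (openCovers (FinPows X))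
      (omegaCovers X) (omegaCovers X) :=
    IsFinitePower.leTwoFin_cube (fun _ => image_finPowsSet_mem_openCovers)
      mem_omegaCovers_of_image_finPowsSet
  exact ⟨⟨hpi.equiv1, hpi.equiv1.symm_trans hpow.equiv1,
      .of_le leTwo1_omegaCovers_openCovers
        (hcube₁.trans (hpow.truncTranslation.leTwo1 hpow.oneConst1_of_power))⟩,
    hpi.equivFin, hpi.equivFin.symm_trans hpow.equivFin,
    .of_le leTwoFin_omegaCovers_openCovers
      (hcubeFin.trans (hpow.truncTranslation.leTwoFin hpow.oneConstFin_of_power))⟩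
end

section
/- Let X be an infinite Hausdorff space. (a) If 𝒰 is an ω-cover of X, then { [U] ∩ P_fin(X) : U ∈ 𝒰 } is an ω-cover of P_fin(X). (b) If 𝒰 is an ω-cover of P_fin(X), then 𝒱 = { V ∈ 𝒯_X : there exists U ∈ 𝒰 with [V] ∩ P_fin(X) ⊆ U } is an ω-cover of X. -/
open Set

/-- A Vietoris-open set containing `K` contains every compact set that is covered by, and meets
each of, suitable open neighbourhoods of the points of `K`. -/
theorem exists_open_nhds_of_mem_vietoris_open {X : Type*} [TopologicalSpace X]
    {W : Set (KHyper X)} (hW : IsOpen W) {K : KHyper X} (hK : K ∈ W) :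
    ∃ v : X → Set X, (∀ x, IsOpen (v x) ∧ x ∈ v x) ∧
      ∀ H : KHyper X, (H.1 ⊆ ⋃ x ∈ K.1, v x) → (∀ x ∈ K.1, (H.1 ∩ v x).Nonempty) → H ∈ W := by
  classical
  have point_nhds (U : Set X) (hU : IsOpen U) (x : X) :
      IsOpen (if x ∈ U then U else univ) ∧ x ∈ (if x ∈ U then U else univ) := by
    split_ifs with hx
    · exact ⟨hU, hx⟩
    · exact ⟨isOpen_univ, mem_univ x⟩
  induction hW with
  | basic S hS =>
    rcases hS with ⟨U, hU, rfl⟩ | ⟨U, hU, rfl⟩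
    · refine ⟨fun x => if x ∈ U then U else univ, point_nhds U hU, fun H hsub _ y hy => ?_⟩
      obtain ⟨x, hx, hyx⟩ := mem_iUnion₂.1 (hsub hy)
      simpa only [if_pos (hK hx)] using hyx
    · refine ⟨fun x => if x ∈ U then U else univ, point_nhds U hU, fun H _ hmeet => ?_⟩
      obtain ⟨x, hx, hxU⟩ := hK
      simpa only [if_pos hxU, mem_ofPred_eq] using hmeet x hx
  | univ => exact ⟨fun _ => univ, fun x => ⟨isOpen_univ, mem_univ x⟩, fun _ _ _ => mem_univ _⟩
  | inter S T _ _ ihS ihT =>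
    obtain ⟨v, hv, hvS⟩ := ihS hK.1
    obtain ⟨w, hw, hwT⟩ := ihT hK.2
    refine ⟨fun x => v x ∩ w x, fun x => ⟨(hv x).1.inter (hw x).1, (hv x).2, (hw x).2⟩,
      fun H hsub hmeet => ⟨hvS H ?_ ?_, hwT H ?_ ?_⟩⟩
    · exact hsub.trans (iUnion₂_mono fun _ _ => inter_subset_left)
    · exact fun x hx => (hmeet x hx).mono (inter_subset_inter_right _ inter_subset_left)
    · exact hsub.trans (iUnion₂_mono fun _ _ => inter_subset_right)
    · exact fun x hx => (hmeet x hx).mono (inter_subset_inter_right _ inter_subset_right)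
  | sUnion 𝒮 _ ih =>
    obtain ⟨S, hS, hKS⟩ := hK
    obtain ⟨v, hv, hvS⟩ := ih S hS hKS
    exact ⟨v, hv, fun H hsub hmeet => ⟨S, hS, hvS H hsub hmeet⟩⟩

/-- A nonempty finite set as a point of `P_fin(X)`. -/
def Set.Finite.toPFinH {X : Type*} [TopologicalSpace X] {F : Set X} (hF : F.Finite)
    (hne : F.Nonempty) : PFinH X :=
  ⟨⟨F, hF.isCompact, hne⟩, hF⟩

theorem finite_setOf_pFinH_subset {X : Type*} [TopologicalSpace X] {F : Set X} (hF : F.Finite) :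
    {G : PFinH X | G.1.1 ⊆ F}.Finite :=
  hF.finite_subsets.preimage fun _ _ _ _ h => Subtype.ext (Subtype.ext h)

/-- If an open subset of `P_fin(X)` contains all nonempty subsets of a finite set `F`, then it
contains all nonempty finite subsets of some open neighbourhood of `F`. -/
theorem exists_open_superset_of_pFinH_subset {X : Type*} [TopologicalSpace X] {F : Set X}
    (hF : F.Finite) {U : Set (PFinH X)} (hU : IsOpen U) (hFU : {G : PFinH X | G.1.1 ⊆ F} ⊆ U) :
    ∃ V, IsOpen V ∧ F ⊆ V ∧ {G : PFinH X | G.1.1 ⊆ V} ⊆ U := by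
  obtain ⟨W, hW, rfl⟩ := isOpen_induced_iff.1 hU
  have point_nhds (G : PFinH X) : ∃ v : X → Set X, (∀ x, IsOpen (v x) ∧ x ∈ v x) ∧
      (G.1.1 ⊆ F → ∀ H : KHyper X, (H.1 ⊆ ⋃ x ∈ G.1.1, v x) →
        (∀ x ∈ G.1.1, (H.1 ∩ v x).Nonempty) → H ∈ W) := by
    by_cases hG : G.1.1 ⊆ F
    · obtain ⟨v, hv, hvW⟩ := exists_open_nhds_of_mem_vietoris_open hW (hFU hG)
      exact ⟨v, hv, fun _ => hvW⟩
    · exact ⟨fun _ => univ, fun x => ⟨isOpen_univ, mem_univ x⟩, fun h => absurd h hG⟩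
  choose v hv hvW using point_nhds
  set w : X → Set X := fun x => ⋂ G ∈ {G : PFinH X | G.1.1 ⊆ F}, v G x
  have hw_open (x : X) : IsOpen (w x) :=
    (finite_setOf_pFinH_subset hF).isOpen_biInter fun G _ => (hv G x).1
  have hw_mem (x : X) : x ∈ w x := mem_iInter₂.2 fun G _ => (hv G x).2
  refine ⟨⋃ x ∈ F, w x, isOpen_biUnion fun x _ => hw_open x,
    fun x hx => mem_biUnion hx (hw_mem x), fun H hH => ?_⟩
  have hcover : ∀ y ∈ H.1.1, ∃ x ∈ F, y ∈ w x := fun y hy => by simpa using hH hy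
  have hne : {x ∈ F | (H.1.1 ∩ w x).Nonempty}.Nonempty := by
    obtain ⟨y, hy⟩ := H.1.2.2
    obtain ⟨x, hx, hyx⟩ := hcover y hy
    exact ⟨x, hx, y, hy, hyx⟩
  set G : PFinH X := (hF.subset (sep_subset F _)).toPFinH hne
  have hGF : G.1.1 ⊆ F := sep_subset F _
  have hwv (x : X) : w x ⊆ v G x := biInter_subset_of_mem hGF
  refine hvW G hGF H.1 (fun y hy => ?_) fun x hx => hx.2.mono (inter_subset_inter_right _ (hwv x))
  obtain ⟨x, hx, hyx⟩ := hcover y hy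
  exact mem_biUnion (show x ∈ G.1.1 from ⟨hx, y, hy, hyx⟩) (hwv x hyx)

theorem isOpen_setOf_pFinH_subset {X : Type*} [TopologicalSpace X] {U : Set X} (hU : IsOpen U) :
    IsOpen {F : PFinH X | F.1.1 ⊆ U} :=
  isOpen_induced_iff.2
    ⟨{K | K.1 ⊆ U}, TopologicalSpace.isOpen_generateFrom_of_mem (Or.inl ⟨U, hU, rfl⟩), rfl⟩

/-- The covering condition in the definition of an ω-cover follows from the condition on finite
sets. -/
theorem isOmegaCover_of_finite_subset {Y : Type*} [TopologicalSpace Y] {𝒰 : Set (Set Y)}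
    (hopen : ∀ U ∈ 𝒰, IsOpen U) (huniv : univ ∉ 𝒰)
    (hfin : ∀ F : Set Y, F.Finite → ∃ U ∈ 𝒰, F ⊆ U) : IsOmegaCover Y 𝒰 :=
  ⟨⟨hopen, sUnion_eq_univ_iff.2 fun y => by simpa using hfin {y} (finite_singleton y), huniv⟩, hfin⟩

/-- ω-cover translation for `P_fin(X)`:
(a) if `𝒰` is an ω-cover of `X`, then `{[U] ∩ P_fin(X) : U ∈ 𝒰}` is an
ω-cover of `P_fin(X)`;
(b) if `𝒰` is an ω-cover of `P_fin(X)`, then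
`𝒱 = {V ∈ 𝒯_X : ∃ U ∈ 𝒰, [V] ∩ P_fin(X) ⊆ U}` is an ω-cover of `X`. -/
theorem statement9 {X : Type*} [TopologicalSpace X] [T2Space X] [Infinite X] :
    (∀ 𝒰 : Set (Set X), IsOmegaCover X 𝒰 →
      IsOmegaCover (PFinH X) ((fun U => {F : PFinH X | F.1.1 ⊆ U}) '' 𝒰)) ∧
    (∀ 𝒰 : Set (Set (PFinH X)), IsOmegaCover (PFinH X) 𝒰 →
      IsOmegaCover X
        {V | V ∈ ProperNonemptyOpens X ∧
          ∃ U ∈ 𝒰, {F : PFinH X | F.1.1 ⊆ V} ⊆ U}) := by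
  refine ⟨fun 𝒰 h => ?_, fun 𝒰 h => ?_⟩
  · obtain ⟨⟨hopen, -, huniv⟩, hfin⟩ := h
    refine isOmegaCover_of_finite_subset ?_ ?_ fun A hA => ?_
    · rintro _ ⟨U, hU, rfl⟩
      exact isOpen_setOf_pFinH_subset (hopen U hU)
    · rintro ⟨U, hU, hUuniv⟩
      refine huniv ((eq_univ_of_forall fun x => ?_ : U = univ) ▸ hU)
      have hx : (finite_singleton x).toPFinH (singleton_nonempty x) ∈ {F : PFinH X | F.1.1 ⊆ U} :=
        (Set.ext_iff.1 hUuniv _).2 (mem_univ _)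
      exact hx rfl
    · obtain ⟨U, hU, hsub⟩ := hfin (⋃ G ∈ A, G.1.1) (hA.biUnion fun G _ => G.2)
      exact ⟨_, mem_image_of_mem _ hU, fun G hG => (subset_biUnion_of_mem hG).trans hsub⟩
  · obtain ⟨⟨hopen, -, huniv⟩, hfin⟩ := h
    refine isOmegaCover_of_finite_subset (fun V hV => hV.1.1) (fun hV => hV.1.2.2 rfl)
      fun F hF => ?_
    obtain ⟨x₀⟩ : Nonempty X := inferInstance
    have hF' : (insert x₀ F).Finite := hF.insert x₀
    obtain ⟨U, hU, hFU⟩ := hfin _ (finite_setOf_pFinH_subset hF')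
    obtain ⟨V, hV, hFV, hVU⟩ := exists_open_superset_of_pFinH_subset hF' (hopen U hU) hFU
    refine ⟨V, ⟨⟨hV, ⟨x₀, hFV (mem_insert x₀ F)⟩, ?_⟩, U, hU, hVU⟩, (subset_insert x₀ F).trans hFV⟩
    rintro rfl
    exact huniv ((eq_univ_of_forall fun G => hVU (subset_univ G.1.1) : U = univ) ▸ hU)
end
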